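/- Let φ be a nonnegative function in L¹_loc(0,∞) with ∫₀^∞ φ(t) dt < ∞. Then H_φ commutes with the Hilbert transform on the real Hardy space H¹(ℝ): for every f ∈ H¹(ℝ), H_φ(H f) = H(H_φ f) almost everywhere on ℝ. -/

import Mathlib

open MeasureTheory Complex Filter Set Topology ENNReal NNReal

/-- The Hausdorff operator on functions on the real line:
`H_φ f (x) = ∫₀^∞ f(x/t) φ(t)/t dt`. -/
noncomputable def hausdorffR (φ : ℝ → ℝ) (f : ℝ → ℂ) (x : ℝ) : ℂ :=
  ∫ t in Set.Ioi (0 : ℝ), (φ t / t) • f (x / t)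

/-- The Hilbert transform `H f (x) = (1/π) p.v. ∫ f(y)/(x-y) dy`, defined as the
limit as `ε → 0⁺` of the truncated singular integrals. -/
noncomputable def hilbertT (f : ℝ → ℂ) (x : ℝ) : ℂ :=
  (Real.pi)⁻¹ • limUnder (𝓝[>] (0 : ℝ))
    (fun ε : ℝ => ∫ y in {y : ℝ | ε ≤ |x - y|}, f y / ((x : ℂ) - (y : ℂ)))

/-- Membership in the real Hardy space `H¹(ℝ)`: `f ∈ L¹(ℝ)` with `H f ∈ L¹(ℝ)`. -/
def MemH1 (f : ℝ → ℂ) : Prop :=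
  Integrable f volume ∧ Integrable (hilbertT f) volume

/-- The norm on the real Hardy space: `‖f‖ = ‖f‖_{L¹} + ‖H f‖_{L¹}`. -/
noncomputable def h1Norm (f : ℝ → ℂ) : ℝ≥0∞ :=
  eLpNorm f 1 volume + eLpNorm (hilbertT f) 1 volume


noncomputable def pk (y u : ℝ) : ℝ := y / (u ^ 2 + y ^ 2)
noncomputable def qk (y u : ℝ) : ℝ := u / (u ^ 2 + y ^ 2)

lemma pk_nonneg {y : ℝ} (hy : 0 < y) (u : ℝ) : 0 ≤ pk y u := by unfold pk; positivity

lemma radial_aux {x ε t : ℝ} (hε : 0 < ε) (ht : 0 < t) :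
    {a : ℝ | t ≤ ε ^ 2 / ((x - a) ^ 2 + ε ^ 2)} ⊆
      if t ≤ 1 then Metric.closedBall x (ε * t ^ (-(1/2) : ℝ)) else ∅ := by
  intro a ha
  simp only [mem_ofPred_eq] at ha
  have hpos : 0 < (x - a) ^ 2 + ε ^ 2 := by positivity
  rw [le_div_iff₀ hpos] at ha
  have hs : 0 ≤ (x - a) ^ 2 := by positivity
  split_ifs with h
  · rw [Metric.mem_closedBall, Real.dist_eq]
    have h1 : 0 ≤ ε * t ^ (-(1/2) : ℝ) := by positivity
    refine abs_le_of_sq_le_sq ?_ h1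
    have h2 : (t ^ (-(1/2) : ℝ)) ^ 2 = t⁻¹ := by
      rw [← Real.rpow_natCast, ← Real.rpow_mul ht.le, ← Real.rpow_neg_one]; norm_num
    rw [mul_pow, h2, ← div_eq_mul_inv, le_div_iff₀ ht]
    nlinarith [sq_nonneg ε]
  · push Not at h
    have : ε ^ 2 < t * ε ^ 2 := by
      have : 0 < ε ^ 2 := by positivity
      nlinarith
    have : 0 ≤ t * (x - a) ^ 2 := by positivity
    nlinarith

lemma radial (μ : Measure ℝ) (x : ℝ) (C : ℝ≥0∞) (hC : C ≠ ∞)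
    (hb : ∀ r > 0, μ (Metric.closedBall x r) ≤ C * ENNReal.ofReal r)
    (h0 : Tendsto (fun r => μ (Metric.closedBall x r) / ENNReal.ofReal r) (𝓝[>] 0) (𝓝 0)) :
    Tendsto (fun ε => ∫⁻ t, ENNReal.ofReal (pk ε (x - t)) ∂μ) (𝓝[>] 0) (𝓝 0) := by
  have key : ∀ ε > 0, ∫⁻ t, ENNReal.ofReal (pk ε (x - t)) ∂μ ≤
      ∫⁻ t in Ioc (0:ℝ) 1, μ (Metric.closedBall x (ε * t ^ (-(1/2) : ℝ))) / ENNReal.ofReal ε := by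
    intro ε hε
    have e1 : ∀ t, ENNReal.ofReal (pk ε (x - t)) =
        ENNReal.ofReal (ε ^ 2 / ((x - t) ^ 2 + ε ^ 2)) * (ENNReal.ofReal ε)⁻¹ := by
      intro t
      rw [← ENNReal.ofReal_inv_of_pos hε, ← ENNReal.ofReal_mul (by positivity)]
      congr 1
      unfold pk; field_simp
    simp_rw [e1, div_eq_mul_inv (μ _)]
    rw [lintegral_mul_const' _ _ (by simp [hε]), lintegral_mul_const' _ _ (by simp [hε])]
    refine mul_le_mul_left ?_ _
    rw [lintegral_eq_lintegral_meas_le μ (Eventually.of_forall fun t => by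
      simp only [Pi.zero_apply]; positivity) (by fun_prop)]
    rw [← lintegral_indicator measurableSet_Ioi, ← lintegral_indicator measurableSet_Ioc]
    apply lintegral_mono
    intro t
    by_cases ht : 0 < t
    · rw [indicator_of_mem (by exact ht)]
      have := measure_mono (μ := μ) (radial_aux (x := x) hε ht)
      refine this.trans ?_
      split_ifs with h
      · rw [indicator_of_mem (by exact ⟨ht, h⟩)]
      · simp
    · rw [indicator_of_notMem (by simpa using ht)]; simp
  have lim : Tendsto (fun ε => ∫⁻ t in Ioc (0:ℝ) 1,
      μ (Metric.closedBall x (ε * t ^ (-(1/2) : ℝ))) / ENNReal.ofReal ε) (𝓝[>] 0) (𝓝 0) := by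
    have : (0 : ℝ≥0∞) = ∫⁻ t in Ioc (0:ℝ) 1, 0 := by simp
    rw [show 𝓝 (0:ℝ≥0∞) = 𝓝 (∫⁻ t in Ioc (0:ℝ) 1, (0:ℝ≥0∞)) by rw [← this]]
    apply tendsto_lintegral_filter_of_dominated_convergence
      (fun t => C * ENNReal.ofReal (t ^ (-(1/2) : ℝ)))
    · refine Eventually.of_forall fun ε => ?_
      have hm : Monotone (fun r : ℝ => μ (Metric.closedBall x r)) := fun a b h =>
        measure_mono (Metric.closedBall_subset_closedBall h)
      have := hm.measurable
      have h2 : Measurable fun t : ℝ => ε * t ^ (-(1/2) : ℝ) := by fun_prop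
      exact (this.comp h2).div_const _
    · filter_upwards [self_mem_nhdsWithin] with ε hε
      filter_upwards [ae_restrict_mem measurableSet_Ioc] with t ht
      simp only [mem_Ioi] at hε
      have hp : 0 < t ^ (-(1/2) : ℝ) := Real.rpow_pos_of_pos ht.1 _
      rw [ENNReal.div_le_iff (by simp [hε]) (by simp)]
      refine (hb _ (by positivity)).trans ?_
      rw [ENNReal.ofReal_mul hε.le]
      apply le_of_eq; ring
    · rw [lintegral_const_mul' _ _ hC]
      apply ENNReal.mul_ne_top hC
      have : IntegrableOn (fun t : ℝ => t ^ (-(1/2) : ℝ)) (Ioc 0 1) := by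
        have := intervalIntegral.intervalIntegrable_rpow' (a := 0) (b := 1) (r := -(1/2)) (by norm_num)
        rwa [intervalIntegrable_iff_integrableOn_Ioc_of_le (by norm_num)] at this
      exact this.lintegral_lt_top.ne
    · filter_upwards [ae_restrict_mem measurableSet_Ioc] with t ht
      have hp : 0 < t ^ (-(1/2) : ℝ) := Real.rpow_pos_of_pos ht.1 _
      set p := t ^ (-(1/2) : ℝ)
      have h1 : Tendsto (fun ε : ℝ => ε * p) (𝓝[>] 0) (𝓝[>] 0) := by
        apply tendsto_nhdsWithin_iff.2 ⟨?_, ?_⟩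
        · have : Tendsto (fun ε : ℝ => ε * p) (𝓝 0) (𝓝 (0 * p)) := by
            exact (continuous_id.mul continuous_const).tendsto _
          rw [zero_mul] at this
          exact this.mono_left nhdsWithin_le_nhds
        · filter_upwards [self_mem_nhdsWithin] with ε hε
          exact mul_pos hε hp
      have h2 := ENNReal.Tendsto.mul_const (b := ENNReal.ofReal p) (h0.comp h1) (by simp)
      rw [zero_mul] at h2
      refine h2.congr' ?_
      filter_upwards [self_mem_nhdsWithin] with ε hε
      simp only [mem_Ioi] at hε
      simp only [Function.comp]
      rw [ENNReal.ofReal_mul hε.le, div_eq_mul_inv, div_eq_mul_inv, ENNReal.mul_inv (by simp) (by simp),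
        mul_assoc, mul_assoc, ENNReal.inv_mul_cancel (by simp [hp]) (by simp), mul_one]
  apply tendsto_of_tendsto_of_tendsto_of_le_of_le' tendsto_const_nhds lim
  · exact Eventually.of_forall fun _ => zero_le
  · filter_upwards [self_mem_nhdsWithin] with ε hε using key ε hε

lemma leb_ball (g : ℝ → ℂ) (hg : Integrable g) : ∀ᵐ x, Tendsto (fun r => 
    (∫⁻ t in Metric.closedBall x r, ‖g t - g x‖ₑ) / ENNReal.ofReal r) (𝓝[>] 0) (𝓝 0) := by
  filter_upwards [(IsUnifLocDoublingMeasure.vitaliFamily (volume : Measure ℝ) 1).ae_tendsto_lintegral_enorm_sub_div hg.locallyIntegrable] with x hx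
  have h1 := hx.comp (IsUnifLocDoublingMeasure.tendsto_closedBall_filterAt (volume : Measure ℝ) (K := 1) (x := x) 
    (fun _ : ℝ => x) (fun r : ℝ => r) (l := 𝓝[>] 0) tendsto_id (by
    filter_upwards [self_mem_nhdsWithin] with ε hε
    simp [le_of_lt (show (0:ℝ) < ε from hε)]))
  have h2 := ENNReal.Tendsto.mul_const (b := 2) h1 (by simp)
  rw [zero_mul] at h2
  refine h2.congr' ?_
  filter_upwards [self_mem_nhdsWithin] with ε hε
  simp only [Function.comp, Real.volume_closedBall]
  rw [ENNReal.ofReal_mul (by norm_num), div_eq_mul_inv, div_eq_mul_inv, ENNReal.mul_inv (by simp) (by simp),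
    mul_assoc, mul_comm _ (2 : ℝ≥0∞)]
  simp only [ENNReal.ofReal_ofNat]
  rw [← mul_assoc 2, ENNReal.mul_inv_cancel (by simp) (by simp), one_mul]

lemma leb_pk (g : ℝ → ℂ) (hg : Integrable g) : ∀ᵐ x, Tendsto (fun ε =>
    ∫⁻ t, ‖g t - g x‖ₑ * ENNReal.ofReal (pk ε (x - t))) (𝓝[>] 0) (𝓝 0) := by
  filter_upwards [leb_ball g hg] with x hx
  set μ : Measure ℝ := volume.withDensity (fun t => ‖g t - g x‖ₑ) with hμ
  have hμb : ∀ r, μ (Metric.closedBall x r) = ∫⁻ t in Metric.closedBall x r, ‖g t - g x‖ₑ := fun r =>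
    withDensity_apply _ Metric.isClosed_closedBall.measurableSet
  have hmeas : AEMeasurable (fun t => ‖g t - g x‖ₑ) volume :=
    (hg.aestronglyMeasurable.sub aestronglyMeasurable_const).enorm
  simp_rw [← hμb] at hx
  have hev := (ENNReal.tendsto_nhds_zero.1 hx) 1 (by simp)
  obtain ⟨r0, hr0, hr⟩ := mem_nhdsGT_iff_exists_Ioc_subset.1 hev
  simp only [mem_Ioi] at hr0
  have hgn : ∫⁻ t, ‖g t‖ₑ ≠ ∞ := hg.hasFiniteIntegral.ne
  have := radial μ x (1 + ((∫⁻ t, ‖g t‖ₑ) / ENNReal.ofReal r0 + ‖g x‖ₑ * 2)) (by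
      simp only [ne_eq, ENNReal.add_eq_top, not_or]
      refine ⟨by simp, ENNReal.div_ne_top hgn (by simp [hr0]), ENNReal.mul_ne_top (by simp) (by simp)⟩) ?_ hx
  · refine this.congr fun ε => ?_
    rw [hμ, lintegral_withDensity_eq_lintegral_mul₀ hmeas (by unfold pk; fun_prop)]
    rfl
  · intro r hrp
    rcases le_or_gt r r0 with h | h
    · have := hr ⟨hrp, h⟩
      simp only [mem_ofPred_eq] at this
      rw [ENNReal.div_le_iff (by simpa using hrp) (by simp)] at this
      refine this.trans ?_
      gcongr
      exact le_self_add
    · rw [hμb]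
      calc ∫⁻ t in Metric.closedBall x r, ‖g t - g x‖ₑ 
          ≤ ∫⁻ t in Metric.closedBall x r, (‖g t‖ₑ + ‖g x‖ₑ) := by
            apply lintegral_mono; intro t; exact enorm_sub_le
        _ = (∫⁻ t in Metric.closedBall x r, ‖g t‖ₑ) + ‖g x‖ₑ * ENNReal.ofReal (2 * r) := by
            rw [lintegral_add_right _ measurable_const]; simp
        _ ≤ (∫⁻ t, ‖g t‖ₑ) + ‖g x‖ₑ * ENNReal.ofReal (2 * r) := by
            gcongr; exact Measure.restrict_le_self
        _ ≤ ((∫⁻ t, ‖g t‖ₑ) / ENNReal.ofReal r0 + ‖g x‖ₑ * 2) * ENNReal.ofReal r := by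
            rw [add_mul, ENNReal.ofReal_mul (by norm_num), mul_assoc]
            simp only [ENNReal.ofReal_ofNat]
            gcongr
            rw [ENNReal.div_eq_inv_mul, mul_comm, ← mul_assoc]
            apply le_mul_of_one_le_left (by simp)
            rw [← div_eq_mul_inv, ENNReal.le_div_iff_mul_le (by simp [hr0]) (by simp)]
            simpa using ENNReal.ofReal_le_ofReal h.le
        _ ≤ _ := by exact mul_le_mul_left le_add_self _

lemma leb_kernel (g : ℝ → ℂ) (hg : Integrable g) : ∀ᵐ x, ∀ k : ℝ → ℝ → ℝ,
    (∀ ε > 0, ∀ u, |k ε u| ≤ pk ε u) → 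
    Tendsto (fun ε => ∫ t, (k ε (x - t) : ℂ) * (g t - g x)) (𝓝[>] 0) (𝓝 0) := by
  filter_upwards [leb_pk g hg] with x hx k hk
  rw [tendsto_zero_iff_enorm_tendsto_zero]
  apply tendsto_of_tendsto_of_tendsto_of_le_of_le' tendsto_const_nhds hx
  · exact Eventually.of_forall fun _ => zero_le
  · filter_upwards [self_mem_nhdsWithin] with ε hε
    refine (enorm_integral_le_lintegral_enorm _).trans (lintegral_mono fun t => ?_)
    simp only [enorm_mul]
    rw [mul_comm]
    gcongr
    rw [← ofReal_norm]
    apply ENNReal.ofReal_le_ofReal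
    simpa using hk ε hε _


lemma integrable_toC {f : ℝ → ℝ} (h : Integrable f) : Integrable (fun t => ((f t : ℝ) : ℂ)) := h.ofReal

lemma pk_eq {ε : ℝ} (hε : 0 < ε) (u : ℝ) : pk ε u = ε⁻¹ * (1 + (u / ε) ^ 2)⁻¹ := by
  unfold pk; field_simp; ring

lemma pk_integrable0 {ε : ℝ} (hε : 0 < ε) : Integrable (pk ε) := by
  have h : pk ε = fun u => ε⁻¹ * (1 + (u / ε) ^ 2)⁻¹ := funext (pk_eq hε)
  rw [h]
  exact (integrable_inv_one_add_sq.comp_div hε.ne').const_mul _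

lemma pk_integrable {ε : ℝ} (hε : 0 < ε) (x : ℝ) : Integrable (fun t => pk ε (x - t)) :=
  (pk_integrable0 hε).comp_sub_left x

lemma pk_integral {ε : ℝ} (hε : 0 < ε) (x : ℝ) : ∫ t, pk ε (x - t) = Real.pi := by
  rw [integral_sub_left_eq_self (pk ε) volume x]
  have h : pk ε = fun u => ε⁻¹ * (1 + (u / ε) ^ 2)⁻¹ := funext (pk_eq hε)
  rw [h, integral_const_mul, Measure.integral_comp_div (fun u => (1 + u ^ 2)⁻¹),
    integral_univ_inv_one_add_sq, abs_of_pos hε, smul_eq_mul, ← mul_assoc,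
    inv_mul_cancel₀ hε.ne', one_mul]

lemma pk_cont {ε : ℝ} (hε : 0 < ε) : Continuous (pk ε) := by
  unfold pk
  exact continuous_const.div (by fun_prop) fun u => by positivity

lemma qk_cont {ε : ℝ} (hε : 0 < ε) : Continuous (qk ε) := by
  unfold qk
  exact continuous_id.div (by fun_prop) fun u => by positivity

lemma pk_bound {ε : ℝ} (hε : 0 < ε) (u : ℝ) : |pk ε u| ≤ ε⁻¹ := by
  rw [abs_of_nonneg (pk_nonneg hε u)]
  unfold pk
  rw [div_le_iff₀ (by positivity)]
  field_simp
  nlinarith [sq_nonneg u]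

lemma qk_bound {ε : ℝ} (hε : 0 < ε) (u : ℝ) : |qk ε u| ≤ ε⁻¹ := by
  unfold qk
  rw [abs_div, abs_of_pos (show 0 < u ^ 2 + ε ^ 2 by positivity), div_le_iff₀ (by positivity)]
  field_simp
  nlinarith [sq_abs u, sq_nonneg (|u| - ε), abs_nonneg u]

noncomputable def PI (f : ℝ → ℂ) (x y : ℝ) : ℂ := ∫ t, (pk y (x - t) : ℂ) * f t
noncomputable def QI (f : ℝ → ℂ) (x y : ℝ) : ℂ := ∫ t, (qk y (x - t) : ℂ) * f t

lemma kernel_mul_integrable {f : ℝ → ℂ} (hf : Integrable f) {k : ℝ → ℝ} (hk : Measurable k) {C : ℝ}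
    (hC : ∀ u, |k u| ≤ C) (x : ℝ) : Integrable (fun t => (k (x - t) : ℂ) * f t) := by
  apply hf.bdd_mul (c := C)
  · exact (by fun_prop : Measurable fun t => (k (x - t) : ℂ)).aestronglyMeasurable
  · exact Eventually.of_forall fun t => by simpa using hC (x - t)

lemma PI_integrable {f : ℝ → ℂ} (hf : Integrable f) {y : ℝ} (hy : 0 < y) (x : ℝ) :
    Integrable (fun t => (pk y (x - t) : ℂ) * f t) :=
  kernel_mul_integrable hf (pk_cont hy).measurable (pk_bound hy) x

lemma QI_integrable {f : ℝ → ℂ} (hf : Integrable f) {y : ℝ} (hy : 0 < y) (x : ℝ) :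
    Integrable (fun t => (qk y (x - t) : ℂ) * f t) :=
  kernel_mul_integrable hf (qk_cont hy).measurable (qk_bound hy) x

lemma PI_tendsto (g : ℝ → ℂ) (hg : Integrable g) :
    ∀ᵐ x, Tendsto (fun ε => PI g x ε) (𝓝[>] 0) (𝓝 (Real.pi * g x)) := by
  filter_upwards [leb_kernel g hg] with x hx
  have h1 := hx pk (fun ε hε u => by rw [abs_of_nonneg (pk_nonneg hε u)])
  have h2 := h1.add_const (Real.pi * g x)
  rw [zero_add] at h2
  refine h2.congr' ?_
  filter_upwards [self_mem_nhdsWithin] with ε hε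
  simp only [mem_Ioi] at hε
  simp_rw [mul_sub]
  rw [integral_sub (PI_integrable hg hε x) ((integrable_toC (pk_integrable hε x)).mul_const _),
    integral_mul_const, integral_complex_ofReal, pk_integral hε]
  simp [PI]

noncomputable def dk (ε u : ℝ) : ℝ := qk ε u - (if ε ≤ |u| then u⁻¹ else 0)

lemma dk_bound {ε : ℝ} (hε : 0 < ε) (u : ℝ) : |dk ε u| ≤ pk ε u := by
  unfold dk qk pk
  have hp : 0 < u ^ 2 + ε ^ 2 := by positivity
  split_ifs with h
  · have hu0 : 0 < |u| := hε.trans_le h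
    have hu : u ≠ 0 := abs_pos.1 hu0
    have : u / (u ^ 2 + ε ^ 2) - u⁻¹ = - (ε ^ 2 / (u * (u ^ 2 + ε ^ 2))) := by
      field_simp; ring
    rw [this, abs_neg, abs_div, abs_mul, abs_of_pos hp, abs_of_pos (by positivity : 0 < ε ^ 2),
      div_le_div_iff₀ (by positivity) hp]
    have : ε ^ 2 ≤ ε * |u| := by nlinarith
    nlinarith
  · push Not at h
    rw [sub_zero, abs_div, abs_of_pos hp]
    gcongr

lemma dk_meas (ε : ℝ) : Measurable (dk ε) := by
  unfold dk qk
  refine Measurable.sub (by fun_prop) (Measurable.ite ?_ (by fun_prop) (by fun_prop))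
  exact measurableSet_le (by fun_prop) (by fun_prop)

lemma dk_odd (ε u : ℝ) : dk ε (-u) = - dk ε u := by
  unfold dk qk
  simp only [abs_neg, neg_sq]
  split_ifs <;> ring

lemma dk_integrable {ε : ℝ} (hε : 0 < ε) (x : ℝ) : Integrable (fun t => dk ε (x - t)) := by
  refine (pk_integrable hε x).mono' (((dk_meas ε).comp (by fun_prop : Measurable fun t => x - t)).aestronglyMeasurable) (Eventually.of_forall fun t => ?_)
  simpa using dk_bound hε (x - t)

lemma dk_integral (ε : ℝ) (x : ℝ) : ∫ t, dk ε (x - t) = 0 := by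
  rw [integral_sub_left_eq_self (dk ε) volume x]
  have h := integral_neg_eq_self (dk ε) volume
  simp_rw [dk_odd] at h
  rw [integral_neg] at h
  linarith

noncomputable def trunc (f : ℝ → ℂ) (x ε : ℝ) : ℂ := 
  ∫ y in {y : ℝ | ε ≤ |x - y|}, f y / ((x : ℂ) - (y : ℂ))

lemma trunc_eq (f : ℝ → ℂ) (x ε : ℝ) : trunc f x ε =
    ∫ t, ((if ε ≤ |x - t| then (x - t)⁻¹ else 0 : ℝ) : ℂ) * f t := by
  unfold trunc
  rw [← integral_indicator (measurableSet_le (by fun_prop) (by fun_prop))]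
  congr 1; ext t
  simp only [indicator, mem_ofPred_eq]
  split_ifs
  · push_cast; rw [div_eq_mul_inv, mul_comm]
  · simp

lemma QI_trunc (g : ℝ → ℂ) (hg : Integrable g) :
    ∀ᵐ x, Tendsto (fun ε => QI g x ε - trunc g x ε) (𝓝[>] 0) (𝓝 0) := by
  filter_upwards [leb_kernel g hg] with x hx
  have h1 := hx dk (fun ε hε u => dk_bound hε u)
  refine h1.congr' ?_
  filter_upwards [self_mem_nhdsWithin] with ε hε
  simp only [mem_Ioi] at hε
  have hd : Integrable (fun t => (dk ε (x - t) : ℂ) * g t) :=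
    kernel_mul_integrable hg (dk_meas ε) (C := ε⁻¹) (fun u => (dk_bound hε u).trans 
      ((le_abs_self _).trans (pk_bound hε u))) x
  simp_rw [mul_sub]
  rw [integral_sub hd ((integrable_toC (dk_integrable hε x)).mul_const _),
    integral_mul_const, integral_complex_ofReal, dk_integral]
  rw [trunc_eq, QI, ← integral_sub (QI_integrable hg hε x)]
  · simp only [Complex.ofReal_zero, zero_mul, sub_zero]
    congr 1; ext t
    simp only [dk]; push_cast; ring
  · have := (QI_integrable hg hε x).sub hd
    refine this.congr (Eventually.of_forall fun t => ?_)
    simp only [dk, Pi.sub_apply]; push_cast; ring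


lemma poisson_i (U : ℂ → ℂ) (δ : ℝ) (hδ : 0 < δ) (hd : DifferentiableOn ℂ U {z | -δ < z.im})
    (M : ℝ) (hb : ∀ z : ℂ, -δ < z.im → ‖U z‖ ≤ M) :
    ∫ t : ℝ, ((1 + t ^ 2)⁻¹ : ℝ) * U t = Real.pi * U I := by
  have hopen : IsOpen {z : ℂ | -δ < z.im} := isOpen_lt continuous_const continuous_im
  have hM : 0 ≤ M := (norm_nonneg _).trans (hb I (by simp; linarith))
  set k : ℂ → ℂ := fun ζ => dslope U I ζ / (ζ + I) with hk
  have hds : DifferentiableOn ℂ (dslope U I) {z | -δ < z.im} := by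
    rw [Complex.differentiableOn_dslope (hopen.mem_nhds (by simp; linarith))]
    exact hd
  have hkd : DifferentiableOn ℂ k {z | -δ < z.im ∧ -1 < z.im} := by
    apply DifferentiableOn.div (hds.mono fun z hz => hz.1) (by fun_prop)
    intro z hz h0
    have := congrArg Complex.im h0
    simp at this
    have := hz.2
    linarith
  have hkeq : ∀ ζ, ζ ≠ I → k ζ = (U ζ - U I) / (ζ ^ 2 + 1) := by
    intro ζ h
    simp only [hk, dslope_of_ne _ h, slope, vsub_eq_sub, smul_eq_mul]
    have : ζ ^ 2 + 1 = (ζ - I) * (ζ + I) := by ring_nf; simp; ring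
    rw [this, mul_comm (ζ - I), ← div_div, div_eq_mul_inv, div_eq_mul_inv, div_eq_mul_inv]
    ring
  have hkb : ∀ R : ℝ, 2 ≤ R → ∀ ζ : ℂ, 0 ≤ ζ.im → R ≤ ‖ζ‖ → ‖k ζ‖ ≤ 4 * M / R ^ 2 := by
    intro R hR ζ him hζ
    have hne : ζ ≠ I := by rintro rfl; simp at hζ; linarith
    rw [hkeq ζ hne, norm_div]
    have h1 : ‖U ζ - U I‖ ≤ 2 * M := by
      refine (norm_sub_le _ _).trans ?_
      have := hb ζ (by linarith)
      have := hb I (by simp; linarith)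
      linarith
    have h2 : R ^ 2 / 2 ≤ ‖ζ ^ 2 + 1‖ := by
      have : ‖ζ ^ 2‖ - ‖(1:ℂ)‖ ≤ ‖ζ ^ 2 + 1‖ := by
        have := norm_sub_norm_le (ζ ^ 2) (-1)
        simpa using this
      rw [norm_pow, norm_one] at this
      nlinarith
    calc _ ≤ 2 * M / (R ^ 2 / 2) := by gcongr
      _ = _ := by field_simp; ring
  have hrect : ∀ R : ℝ, 2 ≤ R → 
      ‖∫ x : ℝ in (-R)..R, k x‖ ≤ 16 * M / R := by
    intro R hR
    have h0 := integral_boundary_rect_eq_zero_of_differentiableOn k (-R : ℝ) ((R : ℝ) + (R : ℝ) * I) 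
      (hkd.mono (by
        intro z hz
        simp [mem_reProdIm, uIcc_of_le (by linarith : (0:ℝ) ≤ R)] at hz
        have := hz.2.1
        refine ⟨by linarith, by linarith⟩))
    simp only [ofReal_re, ofReal_im, add_re, mul_re, I_re, mul_zero, I_im, mul_one, sub_self, add_zero,
      add_im, mul_im, zero_add, Complex.ofReal_zero, zero_mul] at h0
    have b1 : ‖∫ x : ℝ in (-R)..R, k (x + R * I)‖ ≤ 4 * M / R ^ 2 * |R - -R| := by
      apply intervalIntegral.norm_integral_le_of_norm_le_const
      intro x hx
      apply hkb R hR
      · simp; linarith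
      · have := Complex.abs_im_le_norm (x + R * I)
        simp at this
        exact (le_abs_self R).trans this
    have b2 : ∀ s : ℝ, |s| = R → ‖∫ y : ℝ in (0:ℝ)..R, k (s + y * I)‖ ≤ 4 * M / R ^ 2 * |R - 0| := by
      intro s hs
      apply intervalIntegral.norm_integral_le_of_norm_le_const
      intro y hy
      rw [uIoc_of_le (by linarith)] at hy
      apply hkb R hR
      · simp; linarith [hy.1]
      · have := Complex.abs_re_le_norm (s + y * I)
        simp at this
        exact hs.symm.le.trans this
    have b3 := b2 R (abs_of_pos (by linarith))
    have b4 := b2 (-R) (by rw [abs_neg]; exact abs_of_pos (by linarith))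
    have e : ∫ x : ℝ in (-R)..R, k x = (∫ x : ℝ in (-R)..R, k (x + R * I))
       - I • (∫ y : ℝ in (0:ℝ)..R, k (R + y * I)) + I • (∫ y : ℝ in (0:ℝ)..R, k ((-R : ℝ) + y * I)) := by
      linear_combination h0
    rw [e]
    refine (norm_add_le _ _).trans ?_
    have := norm_sub_le (∫ x : ℝ in (-R)..R, k (x + R * I)) (I • (∫ y : ℝ in (0:ℝ)..R, k (R + y * I)))
    rw [norm_smul, norm_I, one_mul] at this ⊢
    have e2 : 4 * M / R ^ 2 * |R - -R| + 4 * M / R ^ 2 * |R - 0| + 4 * M / R ^ 2 * |R - 0| = 16 * M / R := by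
      rw [sub_zero, sub_neg_eq_add, abs_of_pos (by linarith), abs_of_pos (by linarith)]
      field_simp; ring
    linarith
  have hUc : Continuous fun t : ℝ => U t := by
    rw [continuous_iff_continuousAt]
    intro t
    exact ((hd.differentiableAt (hopen.mem_nhds (by simp; linarith))).continuousAt).comp_of_eq 
      continuous_ofReal.continuousAt rfl
  have hI1 : Integrable (fun t : ℝ => (((1 + t ^ 2)⁻¹ : ℝ) : ℂ) * U t) := by
    apply (integrable_toC integrable_inv_one_add_sq).mul_bdd (c := M) hUc.aestronglyMeasurable
    exact Eventually.of_forall fun t => hb t (by simp; linarith)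
  have hI2 : Integrable (fun t : ℝ => (((1 + t ^ 2)⁻¹ : ℝ) : ℂ) * U I) := 
    (integrable_toC integrable_inv_one_add_sq).mul_const _
  have hke : ∀ t : ℝ, k t = (((1 + t ^ 2)⁻¹ : ℝ) : ℂ) * U t - (((1 + t ^ 2)⁻¹ : ℝ) : ℂ) * U I := by
    intro t
    rw [hkeq t (by intro h; have := congrArg Complex.im h; simp at this)]
    push_cast
    rw [div_eq_mul_inv, add_comm ((t:ℂ)^2)]; ring
  have hkI : Integrable (fun t : ℝ => k t) := by
    simp_rw [hke]; exact hI1.sub hI2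
  have T1 := intervalIntegral_tendsto_integral hkI tendsto_neg_atTop_atBot tendsto_id
  have T2 : Tendsto (fun R : ℝ => ∫ x : ℝ in (-R)..R, k x) atTop (𝓝 0) := by
    apply squeeze_zero_norm' (a := fun R => 16 * M / R)
    · filter_upwards [eventually_ge_atTop 2] with R hR using hrect R hR
    · exact tendsto_const_nhds.div_atTop tendsto_id
  have e := tendsto_nhds_unique T1 T2
  simp_rw [hke] at e
  rw [integral_sub hI1 hI2, integral_mul_const, integral_complex_ofReal, integral_univ_inv_one_add_sq] at e
  linear_combination e

/-- Poisson representation. -/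
lemma poisson_rep (U : ℂ → ℂ) (hd : DifferentiableOn ℂ U {z | 0 < z.im})
    (M : ℝ) (hb : ∀ z : ℂ, 0 < z.im → ‖U z‖ ≤ M) {a y : ℝ} (ha : 0 < a) (hy : 0 < y) (x : ℝ) :
    PI (fun t => U (t + a * I)) x y = Real.pi * U (x + (y + a) * I) := by
  have key := poisson_i (fun z => U (x + a * I + y * z)) (a / y) (by positivity) (by
    apply hd.comp (by fun_prop)
    intro z hz
    simp only [mem_ofPred_eq] at hz
    rw [← neg_div, div_lt_iff₀ hy] at hz
    simp
    linarith) M (by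
    intro z hz
    rw [← neg_div, div_lt_iff₀ hy] at hz
    apply hb
    simp
    linarith)
  rw [show (x : ℂ) + (y + a) * I = x + a * I + y * I by ring, ← key, PI]
  have h1 := integral_sub_left_eq_self (fun u : ℝ => (pk y u : ℂ) * U (x - u + a * I)) volume x
  have h2 := Measure.integral_comp_mul_left (fun u : ℝ => (pk y u : ℂ) * U (x - u + a * I)) (-y)
  have e1 : ∀ t : ℝ, (pk y (x - t) : ℂ) * U (x - (x - t : ℝ) + a * I) = (pk y (x - t) : ℂ) * U (t + a * I) := by
    intro t; push_cast; congr 2; ring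
  simp_rw [e1] at h1
  rw [h1]
  rw [abs_inv, abs_neg, abs_of_pos hy] at h2
  have e2 : ∫ u : ℝ, (pk y u : ℂ) * U (x - u + a * I) = y * (y⁻¹ • ∫ u : ℝ, (pk y u : ℂ) * U (x - u + a * I)) := by
    rw [real_smul, ← mul_assoc, ofReal_inv, mul_inv_cancel₀ (by simpa using hy.ne'), one_mul]
  rw [e2, ← h2, ← integral_const_mul]
  congr 1; ext t
  rw [← mul_assoc]
  congr 1
  · have : y * pk y (-y * t) = (1 + t ^ 2)⁻¹ := by unfold pk; field_simp; ring
    exact_mod_cast this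
  · congr 1; push_cast; ring


lemma shift_line (W : ℂ → ℂ) (c C : ℝ) (hd : DifferentiableOn ℂ W {z | 0 < z.im ∧ z.im < c})
    (hb : ∀ z : ℂ, 0 < z.im → z.im < c → ‖W z‖ ≤ C * (1 + z.re ^ 2)⁻¹) {a b : ℝ} (ha : 0 < a) 
    (hac : a < c) (hb0 : 0 < b) (hbc : b < c) :
    ∫ t : ℝ, W (t + a * I) = ∫ t : ℝ, W (t + b * I) := by
  have hopen : IsOpen {z : ℂ | 0 < z.im ∧ z.im < c} := 
    (isOpen_lt continuous_const continuous_im).inter (isOpen_lt continuous_im continuous_const)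
  have hint : ∀ s : ℝ, 0 < s → s < c → Integrable (fun t : ℝ => W (t + s * I)) := by
    intro s hs hsc
    refine (integrable_inv_one_add_sq.const_mul C).mono' ?_ ?_
    · apply Continuous.aestronglyMeasurable
      exact hd.continuousOn.comp_continuous (by fun_prop) (fun t => by simp [hs, hsc])
    · refine Eventually.of_forall fun t => ?_
      simpa using hb (t + s * I) (by simpa using hs) (by simpa using hsc)
  have T1 := intervalIntegral_tendsto_integral (hint a ha hac) tendsto_neg_atTop_atBot tendsto_id
  have T2 := intervalIntegral_tendsto_integral (hint b hb0 hbc) tendsto_neg_atTop_atBot tendsto_id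
  have T3 := T1.sub T2
  have T4 : Tendsto (fun R : ℝ => (∫ x : ℝ in (-R)..R, W (x + a * I)) - ∫ x : ℝ in (-R)..R, W (x + b * I)) atTop (𝓝 0) := by
    apply squeeze_zero_norm' (a := fun R => 2 * (C * (1 + R ^ 2)⁻¹ * |b - a|))
    · filter_upwards with R
      have hsub : ∀ y ∈ uIcc a b, 0 < y ∧ y < c := by
        intro y hy
        rcases le_total a b with h | h
        · rw [uIcc_of_le h] at hy; exact ⟨by linarith [hy.1], by linarith [hy.2]⟩
        · rw [uIcc_of_ge h] at hy; exact ⟨by linarith [hy.1], by linarith [hy.2]⟩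
      have h0 := integral_boundary_rect_eq_zero_of_differentiableOn W ((-R : ℝ) + a * I) ((R : ℝ) + b * I) 
        (hd.mono (by
          intro z hz
          rw [mem_reProdIm] at hz
          have h2 := hz.2
          simp at h2
          exact hsub _ h2))
      simp only [ofReal_re, ofReal_im, add_re, mul_re, I_re, mul_zero, I_im, mul_one, sub_self, add_zero,
        add_im, mul_im, zero_add] at h0
      have b2 : ∀ s : ℝ, s ^ 2 = R ^ 2 → ‖∫ y : ℝ in a..b, W (s + y * I)‖ ≤ C * (1 + R ^ 2)⁻¹ * |b - a| := by
        intro s hs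
        apply intervalIntegral.norm_integral_le_of_norm_le_const
        intro y hy
        have h1 := hsub y (uIoc_subset_uIcc hy)
        have := hb (s + y * I) (by simpa using h1.1) (by simpa using h1.2)
        simpa [hs] using this
      have b3 := b2 R rfl
      have b4 := b2 (-R) (by ring)
      have e : (∫ x : ℝ in (-R)..R, W (x + a * I)) - ∫ x : ℝ in (-R)..R, W (x + b * I) = 
         I • (∫ y : ℝ in a..b, W ((-R : ℝ) + y * I)) - I • (∫ y : ℝ in a..b, W (R + y * I)) := by
        linear_combination h0
      rw [e]
      refine (norm_sub_le _ _).trans ?_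
      rw [norm_smul, norm_smul, norm_I, one_mul, one_mul]
      linarith
    · have h1 : Tendsto (fun R : ℝ => (1 + R ^ 2)⁻¹) atTop (𝓝 0) := by
        apply Tendsto.inv_tendsto_atTop
        exact tendsto_atTop_add_const_left _ _ (tendsto_pow_atTop (by norm_num))
      have := ((h1.const_mul C).mul_const |b - a|).const_mul 2
      simpa using this
  have := tendsto_nhds_unique T3 T4
  exact sub_eq_zero.1 this

lemma slice_cont (V : ℂ → ℂ) (hd : DifferentiableOn ℂ V {z | 0 < z.im}) {a : ℝ} (ha : 0 < a) : Continuous (fun t : ℝ => V (t + a * I)) :=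
  hd.continuousOn.comp_continuous (by fun_prop) (fun t => by simpa using ha)

lemma inner_eq (V : ℂ → ℂ) (hd : DifferentiableOn ℂ V {z | 0 < z.im})
    (hb : ∀ z : ℂ, 0 < z.im → ‖V z‖ ≤ (1 + z.re ^ 2)⁻¹) {a b : ℝ} (ha : 0 < a) (hb0 : 0 < b) :
    ∫ t : ℝ, V (t + a * I) * (starRingEnd ℂ) (V (t + b * I)) =
      ((∫ t : ℝ, ‖V (t + ((a + b) / 2 : ℝ) * I)‖ ^ 2 : ℝ) : ℂ) := by
  have hopen : IsOpen {z : ℂ | 0 < z.im} := isOpen_lt continuous_const continuous_im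
  have := shift_line (fun z => V z * (starRingEnd ℂ) (V ((starRingEnd ℂ) z + (a + b : ℝ) * I))) (a + b) 1
    ?_ ?_ ha (by linarith) (b := (a + b) / 2) (by linarith) (by linarith)
  · rw [← integral_complex_ofReal]
    convert this using 1
    · congr 1; ext t; congr 3; simp; ring
    · congr 1; ext t
      rw [show (starRingEnd ℂ) ((t:ℂ) + ((a + b) / 2 : ℝ) * I) + (a + b : ℝ) * I = (t:ℂ) + ((a + b) / 2 : ℝ) * I by
        rw [map_add, map_mul, conj_I, conj_ofReal, conj_ofReal]; push_cast; ring]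
      rw [Complex.mul_conj, Complex.normSq_eq_norm_sq]
  · intro z hz
    apply DifferentiableAt.differentiableWithinAt
    apply DifferentiableAt.mul (hd.differentiableAt (hopen.mem_nhds hz.1))
    have h1 : DifferentiableAt ℂ (fun w => V (w + (a + b : ℝ) * I)) ((starRingEnd ℂ) z) := by
      apply DifferentiableAt.comp (g := V) (f := fun w => w + (a + b : ℝ) * I)
      · apply hd.differentiableAt (hopen.mem_nhds _)
        have := hz.2
        simp
        linarith
      · fun_prop
    have := h1.conj_conj
    simpa [Function.comp_def] using this
  · intro z h1 h2
    rw [norm_mul, RCLike.norm_conj, one_mul]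
    have k1 := hb z h1
    have k2 := hb ((starRingEnd ℂ) z + (a + b : ℝ) * I) (by simp; linarith)
    have k3 : ‖V ((starRingEnd ℂ) z + (a + b : ℝ) * I)‖ ≤ 1 := by
      refine k2.trans (inv_le_one_of_one_le₀ ?_)
      nlinarith [sq_nonneg ((starRingEnd ℂ) z + (a + b : ℝ) * I).re]
    calc _ ≤ ‖V z‖ * 1 := by gcongr
      _ ≤ _ := by simpa using k1

lemma sq_integrable (V : ℂ → ℂ) (hd : DifferentiableOn ℂ V {z | 0 < z.im})
    (hb : ∀ z : ℂ, 0 < z.im → ‖V z‖ ≤ (1 + z.re ^ 2)⁻¹) {a b : ℝ} (ha : 0 < a) (hb0 : 0 < b) :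
    Integrable (fun t : ℝ => V (t + a * I) * (starRingEnd ℂ) (V (t + b * I))) := by
  refine integrable_inv_one_add_sq.mono' ?_ (Eventually.of_forall fun t => ?_)
  · exact ((slice_cont V hd ha).mul (Complex.continuous_conj.comp (slice_cont V hd hb0))).aestronglyMeasurable
  · rw [norm_mul, RCLike.norm_conj]
    have k1 := hb (t + a * I) (by simpa using ha)
    have k2 := hb (t + b * I) (by simpa using hb0)
    have k3 : ‖V (t + b * I)‖ ≤ 1 := by
      refine k2.trans (inv_le_one_of_one_le₀ ?_)
      nlinarith [sq_nonneg (t + b * I : ℂ).re]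
    calc _ ≤ ‖V (t + a * I)‖ * 1 := by gcongr
      _ ≤ _ := by simpa using k1

lemma sq_integrable' (V : ℂ → ℂ) (hd : DifferentiableOn ℂ V {z | 0 < z.im})
    (hb : ∀ z : ℂ, 0 < z.im → ‖V z‖ ≤ (1 + z.re ^ 2)⁻¹) {a : ℝ} (ha : 0 < a) : Integrable (fun t : ℝ => ‖V (t + a * I)‖ ^ 2) := by
  refine (sq_integrable V hd hb ha ha).norm.congr (Eventually.of_forall fun t => ?_)
  simp [sq]

lemma slice_sub_sq (V : ℂ → ℂ) (hd : DifferentiableOn ℂ V {z | 0 < z.im})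
    (hb : ∀ z : ℂ, 0 < z.im → ‖V z‖ ≤ (1 + z.re ^ 2)⁻¹) {a b : ℝ} (ha : 0 < a) (hb0 : 0 < b) :
    Integrable (fun t : ℝ => ‖V (t + a * I) - V (t + b * I)‖ ^ 2) ∧ 
    ∫ t : ℝ, ‖V (t + a * I) - V (t + b * I)‖ ^ 2 = (∫ t : ℝ, ‖V (t + a * I)‖ ^ 2) +
      (∫ t : ℝ, ‖V (t + b * I)‖ ^ 2) - 2 * ∫ t : ℝ, ‖V (t + ((a + b) / 2 : ℝ) * I)‖ ^ 2 := by
  have h1 := inner_eq V hd hb ha hb0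
  have h2 := congrArg Complex.re h1
  rw [ofReal_re] at h2
  have h3 := (sq_integrable V hd hb ha hb0)
  have h4 : (∫ t : ℝ, V (t + a * I) * (starRingEnd ℂ) (V (t + b * I))).re = 
    ∫ t : ℝ, (V (t + a * I) * (starRingEnd ℂ) (V (t + b * I))).re := by
    exact (integral_re (𝕜 := ℂ) h3).symm
  have e : ∀ t : ℝ, ‖V (t + a * I) - V (t + b * I)‖ ^ 2 = ‖V (t + a * I)‖ ^ 2 + ‖V (t + b * I)‖ ^ 2
      - 2 * (V (t + a * I) * (starRingEnd ℂ) (V (t + b * I))).re := by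
    intro t
    simp only [← Complex.normSq_eq_norm_sq, Complex.normSq_sub]
  have ia := sq_integrable' V hd hb ha
  have ib := sq_integrable' V hd hb hb0
  have ic : Integrable (fun t : ℝ => 2 * (V (t + a * I) * (starRingEnd ℂ) (V (t + b * I))).re) := 
    (h3.re).const_mul 2
  simp_rw [e]
  refine ⟨(ia.add ib).sub ic, ?_⟩
  rw [integral_sub (f := fun t : ℝ => ‖V (t + a * I)‖ ^ 2 + ‖V (t + b * I)‖ ^ 2) (ia.add ib) ic, integral_add ia ib, integral_const_mul, ← h4, h2]

lemma midconvex_antitone (N : ℝ → ℝ) (B : ℝ) (hB : ∀ a > 0, N a ≤ B) 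
    (hm : ∀ a > 0, ∀ b > 0, 2 * N ((a + b) / 2) ≤ N a + N b) {a b : ℝ} (ha : 0 < a) (hab : a < b) :
    N b ≤ N a := by
  by_contra! hlt
  set d := b - a with hdd
  have hd : 0 < d := by linarith
  have step : ∀ k : ℕ, N b - N a ≤ N (a + (k + 1 : ℕ) * d) - N (a + k * d) := by
    intro k
    induction k with
    | zero => simp [hdd]
    | succ k ih =>
      have := hm (a + k * d) (by positivity) (a + (k + 1 + 1 : ℕ) * d) (by positivity)
      rw [show (a + k * d + (a + (k + 1 + 1 : ℕ) * d)) / 2 = a + (k + 1 : ℕ) * d by push_cast; ring] at this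
      linarith
  have tot : ∀ k : ℕ, k * (N b - N a) + N a ≤ N (a + k * d) := by
    intro k
    induction k with
    | zero => simp
    | succ k ih => have := step k; push_cast at *; linarith
  obtain ⟨k, hk⟩ := exists_nat_gt ((B - N a) / (N b - N a))
  rw [div_lt_iff₀ (by linarith)] at hk
  have := tot k
  have := hB (a + k * d) (by positivity)
  linarith

lemma midconvex_cauchy (N : ℝ → ℝ) (B : ℝ) (hB : ∀ a > 0, N a ≤ B) 
    (hm : ∀ a > 0, ∀ b > 0, 2 * N ((a + b) / 2) ≤ N a + N b) {η : ℝ} (hη : 0 < η) :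
    ∃ a0 > 0, ∀ a > 0, ∀ b > 0, a ≤ a0 → b ≤ a0 → N a + N b - 2 * N ((a + b) / 2) ≤ η := by
  have hbdd : BddAbove (N '' Ioi 0) := ⟨B, by rintro _ ⟨a, ha, rfl⟩; exact hB a ha⟩
  obtain ⟨_, ⟨a0, ha0, rfl⟩, h⟩ := exists_lt_of_lt_csSup (s := N '' Ioi 0) ⟨_, ⟨1, by simp, rfl⟩⟩ 
    (show sSup (N '' Ioi 0) - η / 2 < sSup (N '' Ioi 0) by linarith)
  refine ⟨a0, ha0, fun a ha b hb h1 h2 => ?_⟩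
  have k1 := le_csSup hbdd ⟨a, ha, rfl⟩
  have k2 := le_csSup hbdd ⟨b, hb, rfl⟩
  have k3 : N a0 ≤ N ((a + b) / 2) := by
    rcases eq_or_lt_of_le (show (a + b) / 2 ≤ a0 by linarith) with h | h
    · rw [h]
    · exact midconvex_antitone N B hB hm (by simp at *; linarith) h
  linarith

lemma fatou (V : ℂ → ℂ) (hd : DifferentiableOn ℂ V {z | 0 < z.im})
    (hb : ∀ z : ℂ, 0 < z.im → ‖V z‖ ≤ (1 + z.re ^ 2)⁻¹) :
    ∀ᵐ x : ℝ, ∃ L : ℂ, Tendsto (fun ε : ℝ => V (x + ε * I)) (𝓝[>] 0) (𝓝 L) := by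
  set N : ℝ → ℝ := fun a => ∫ t : ℝ, ‖V (t + a * I)‖ ^ 2 with hN
  have hV1 : ∀ z : ℂ, 0 < z.im → ‖V z‖ ≤ 1 := by
    intro z hz
    refine (hb z hz).trans (inv_le_one_of_one_le₀ ?_)
    nlinarith [sq_nonneg z.re]
  have hNB : ∀ a > 0, N a ≤ Real.pi := by
    intro a ha
    rw [← integral_univ_inv_one_add_sq]
    apply integral_mono (sq_integrable' V hd hb ha) integrable_inv_one_add_sq
    intro t
    have k1 := hb (t + a * I) (by simpa using ha)
    have k2 := hV1 (t + a * I) (by simpa using ha)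
    simp only
    have : ((t : ℂ) + a * I).re = t := by simp
    rw [this] at k1
    nlinarith [norm_nonneg (V (t + a * I))]
  have hNm : ∀ a > 0, ∀ b > 0, 2 * N ((a + b) / 2) ≤ N a + N b := by
    intro a ha b hb0
    have h1 := (slice_sub_sq V hd hb ha hb0).2
    have h2 : 0 ≤ ∫ t : ℝ, ‖V (t + a * I) - V (t + b * I)‖ ^ 2 := integral_nonneg fun t => by positivity
    simp only [hN]
    linarith
  choose! α hα0 hα using fun n : ℕ => midconvex_cauchy N Real.pi hNB hNm (η := ((1/2) ^ (n+1)) ^ 2) (by positivity)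
  -- decreasing sequence
  have hseq : ∀ n : ℕ, ∃ r : ℝ, 0 < r ∧ r ≤ ((n : ℝ) + 1)⁻¹ ∧ ∀ m ≤ n, r ≤ α m := by
    intro n
    obtain ⟨i, hi, hmin⟩ := (Finset.range (n + 1)).exists_min_image α ⟨0, by simp⟩
    refine ⟨min (α i) ((n : ℝ) + 1)⁻¹, lt_min (hα0 i) (by positivity), min_le_right _ _, fun m hm => ?_⟩
    exact (min_le_left _ _).trans (hmin m (by simp; omega))
  choose a ha0 ha1 haα' using hseq
  have haα : ∀ m n, m ≤ n → a n ≤ α m := fun m n h => haα' n m h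
  have hat : Tendsto a atTop (𝓝 0) := by
    apply squeeze_zero (fun n => (ha0 n).le) ha1
    exact tendsto_inv_atTop_zero.comp (tendsto_atTop_add_const_right _ _ tendsto_natCast_atTop_atTop)
  have hcau := Lp.ae_tendsto_of_cauchy_eLpNorm (μ := (volume : Measure ℝ)) (p := 2) 
    (f := fun n (t : ℝ) => V (t + a n * I)) 
    (fun n => (slice_cont V hd (ha0 n)).aestronglyMeasurable) (by norm_num) 
    (B := fun n => ENNReal.ofReal ((1/2) ^ n)) (by
      have : Summable (fun n : ℕ => ((1/2 : ℝ)) ^ n) := summable_geometric_of_lt_one (by norm_num) (by norm_num)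
      rw [← ENNReal.ofReal_tsum_of_nonneg (fun n => by positivity) this]
      simp) (by
      intro n m k hm hk
      have hh := slice_sub_sq V hd hb (ha0 m) (ha0 k)
      have hlt := hα n (a m) (ha0 m) (a k) (ha0 k) (haα n m hm) (haα n k hk)
      have hmem : MemLp ((fun t : ℝ => V (t + a m * I)) - (fun t : ℝ => V (t + a k * I))) 2 volume := by
        rw [memLp_two_iff_integrable_sq_norm]
        · exact hh.1
        · exact ((slice_cont V hd (ha0 m)).sub (slice_cont V hd (ha0 k))).aestronglyMeasurable
      rw [hmem.eLpNorm_eq_integral_rpow_norm (by norm_num) (by norm_num)]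
      simp only [ENNReal.toReal_ofNat, Real.rpow_ofNat, Pi.sub_apply]
      rw [hh.2]
      apply (ENNReal.ofReal_lt_ofReal_iff (by positivity)).2
      calc _ ≤ (((1/2 : ℝ) ^ (n+1)) ^ 2) ^ ((2:ℝ)⁻¹) := by
            apply Real.rpow_le_rpow _ hlt (by norm_num)
            have := hNm (a m) (ha0 m) (a k) (ha0 k)
            linarith
        _ = (1/2 : ℝ) ^ (n+1) := by
            rw [← Real.rpow_natCast, ← Real.rpow_mul (by positivity)]; norm_num
        _ < (1/2) ^ n := by
            rw [pow_succ]
            have hp : 0 < (1/2 : ℝ) ^ n := by positivity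
            linarith)
  have hex : ∃ u : ℝ → ℂ, ∀ᵐ t : ℝ, Tendsto (fun n => V (t + a n * I)) atTop (𝓝 (u t)) := by
    refine ⟨fun t => limUnder atTop (fun n => V (t + a n * I)), ?_⟩
    filter_upwards [hcau] with t ht
    exact tendsto_nhds_limUnder ht
  obtain ⟨u, hu⟩ := hex
  have hum : AEStronglyMeasurable u volume := 
    aestronglyMeasurable_of_tendsto_ae atTop (fun n => (slice_cont V hd (ha0 n)).aestronglyMeasurable) hu
  have hui : Integrable u := by
    refine integrable_inv_one_add_sq.mono' hum ?_
    filter_upwards [hu] with t ht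
    refine le_of_tendsto ht.norm (Eventually.of_forall fun n => ?_)
    simpa using hb (t + a n * I) (by simpa using ha0 n)
  have hrep : ∀ x y : ℝ, 0 < y → PI u x y = Real.pi * V (x + y * I) := by
    intro x y hy
    have t1 : Tendsto (fun n => PI (fun t => V (t + a n * I)) x y) atTop (𝓝 (PI u x y)) := by
      apply tendsto_integral_of_dominated_convergence (fun t => pk y (x - t))
      · intro n
        exact (Continuous.mul (Complex.continuous_ofReal.comp ((pk_cont hy).comp (by fun_prop))) (slice_cont V hd (ha0 n))).aestronglyMeasurable
      · exact pk_integrable hy x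
      · intro n
        refine Eventually.of_forall fun t => ?_
        rw [norm_mul, norm_real, Real.norm_eq_abs, abs_of_nonneg (pk_nonneg hy _)]
        exact mul_le_of_le_one_right (pk_nonneg hy _) (hV1 _ (by simpa using ha0 n))
      · filter_upwards [hu] with t ht using ht.const_mul _
    have t2 : Tendsto (fun n => (Real.pi : ℂ) * V (x + (y + a n) * I)) atTop (𝓝 (Real.pi * V (x + y * I))) := by
      apply Filter.Tendsto.const_mul
      have hc : ContinuousAt V (x + y * I) := (hd.differentiableAt 
        ((isOpen_lt continuous_const continuous_im).mem_nhds (by simpa using hy))).continuousAt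
      apply hc.tendsto.comp
      have : Tendsto (fun n => (x : ℂ) + (y + (a n : ℝ)) * I) atTop (𝓝 (x + (y + (0 : ℝ)) * I)) := by
        have h := (Complex.continuous_ofReal.tendsto 0).comp hat
        exact ((h.const_add (y : ℂ)).mul_const I).const_add _
      simpa using this
    refine tendsto_nhds_unique t1 (t2.congr fun n => ?_)
    exact (poisson_rep V hd 1 hV1 (ha0 n) hy x).symm
  filter_upwards [PI_tendsto u hui] with x hx
  refine ⟨u x, ?_⟩
  have h1 := hx.const_mul ((Real.pi : ℂ)⁻¹)
  have hpi : (Real.pi : ℂ) ≠ 0 := by simp [Real.pi_ne_zero]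
  rw [← mul_assoc, inv_mul_cancel₀ hpi, one_mul] at h1
  refine h1.congr' ?_
  filter_upwards [self_mem_nhdsWithin] with ε hε
  rw [hrep x ε hε, ← mul_assoc, inv_mul_cancel₀ hpi, one_mul]


lemma exp_lift (c : ℝ → ℂ) (hc : ContinuousOn c (Ioi 0)) (L : ℂ) (hL : L ≠ 0)
    (h : Tendsto (fun ε => Complex.exp (c ε)) (𝓝[>] 0) (𝓝 L)) : 
    ∃ l, Tendsto c (𝓝[>] 0) (𝓝 l) := by
  set w := Complex.log L
  have hw : Complex.exp w = L := Complex.exp_log hL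
  set d : ℝ → ℂ := fun ε => c ε - w with hd
  have hde : Tendsto (fun ε => Complex.exp (d ε)) (𝓝[>] 0) (𝓝 1) := by
    have := h.div_const L
    rw [div_self hL] at this
    refine this.congr fun ε => ?_
    rw [hd]; simp only; rw [Complex.exp_sub, hw]
  have hev : ∀ᶠ ε in 𝓝[>] (0:ℝ), Complex.exp (d ε) ∈ slitPlane := 
    hde.eventually (isOpen_slitPlane.mem_nhds one_mem_slitPlane)
  obtain ⟨δ, hδ, hsub⟩ := mem_nhdsGT_iff_exists_Ioo_subset.1 hev
  simp only [mem_Ioi] at hδ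
  have hdc : ContinuousOn d (Ioo 0 δ) := (hc.mono fun x hx => hx.1).sub continuousOn_const
  set m : ℝ → ℂ := fun ε => d ε - Complex.log (Complex.exp (d ε)) with hm
  have hmc : ContinuousOn m (Ioo 0 δ) := 
    hdc.sub ((Complex.continuous_exp.comp_continuousOn hdc).clog fun x hx => hsub hx)
  have hmi : ∀ ε, ∃ n : ℤ, m ε = n * (2 * Real.pi * I) := by
    intro ε
    rw [← Complex.exp_eq_one_iff, hm]
    simp only
    rw [Complex.exp_sub, Complex.exp_log (Complex.exp_ne_zero _), div_self (Complex.exp_ne_zero _)]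
  choose n hn using hmi
  set r : ℝ → ℝ := fun ε => (m ε).im / (2 * Real.pi) with hr
  have hrc : ContinuousOn r (Ioo 0 δ) := (Complex.continuous_im.comp_continuousOn hmc).div_const _
  have hrn : ∀ ε, r ε = n ε := by
    intro ε
    simp only [hr, hn ε]
    simp
  have hlt : ∀ a ∈ Ioo 0 δ, ∀ b ∈ Ioo 0 δ, ¬ (n a < n b) := by
    intro a ha b hb hab
    have := isPreconnected_Ioo.intermediate_value ha hb hrc
    have h2 : ((n a : ℝ) + 1/2) ∈ Icc (r a) (r b) := by
      rw [hrn, hrn]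
      have : (n a : ℝ) + 1 ≤ n b := by exact_mod_cast hab
      constructor <;> linarith
    obtain ⟨e, -, he⟩ := this h2
    rw [hrn] at he
    have h3 : (2 * n e : ℝ) = 2 * n a + 1 := by linarith
    have h4 : 2 * n e = 2 * n a + 1 := by exact_mod_cast h3
    omega
  have hconst : ∀ a ∈ Ioo 0 δ, m a = m (δ / 2) := by
    intro a ha
    have h2 : δ / 2 ∈ Ioo 0 δ := ⟨by linarith, by linarith⟩
    rw [hn, hn, le_antisymm (not_lt.1 (hlt _ h2 _ ha)) (not_lt.1 (hlt _ ha _ h2))]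
  refine ⟨m (δ / 2) + Complex.log 1 + w, ?_⟩
  have hlog := hde.clog one_mem_slitPlane
  refine ((hlog.const_add (m (δ / 2))).add_const w).congr' ?_
  filter_upwards [Ioo_mem_nhdsGT hδ] with ε hε
  rw [← hconst ε hε]
  simp only [hm, hd]; ring

noncomputable def FF (f : ℝ → ℂ) (z : ℂ) : ℂ := I * ∫ t : ℝ, f t / (z - t)

lemma sub_ne {z : ℂ} (hz : 0 < z.im) (t : ℝ) : z - t ≠ 0 := by
  intro h
  have := congrArg Complex.im h
  simp at this
  linarith

lemma im_le_sub {z : ℂ} (_hz : 0 < z.im) (t : ℝ) : z.im ≤ ‖z - t‖ := by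
  have := Complex.abs_im_le_norm (z - t)
  simp at this
  exact (le_abs_self _).trans this

lemma FF_integrable {f : ℝ → ℂ} (hf : Integrable f) {z : ℂ} (hz : 0 < z.im) : 
    Integrable (fun t : ℝ => f t / (z - t)) := by
  simp_rw [div_eq_mul_inv]
  apply hf.mul_bdd (c := z.im⁻¹)
  · exact (by fun_prop : Measurable fun t : ℝ => (z - t)⁻¹).aestronglyMeasurable
  · refine Eventually.of_forall fun t => ?_
    rw [norm_inv]
    exact inv_anti₀ hz (im_le_sub hz t)

lemma FF_eq {f : ℝ → ℂ} (hf : Integrable f) (x : ℝ) {y : ℝ} (hy : 0 < y) :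
    FF f (x + y * I) = PI f x y + I * QI f x y := by
  unfold FF PI QI
  rw [← integral_const_mul, ← integral_const_mul, ← integral_add (PI_integrable hf hy x) ((QI_integrable hf hy x).const_mul I)]
  congr 1; ext t
  have h1 : ((x : ℂ) + y * I - t) ≠ 0 := sub_ne (by simpa using hy) t
  have h2 : ((((x - t) ^ 2 + y ^ 2 : ℝ)) : ℂ) ≠ 0 := by
    rw [Complex.ofReal_ne_zero]; positivity
  unfold pk qk
  rw [Complex.ofReal_div, Complex.ofReal_div]
  have key : I / ((x : ℂ) + y * I - t) = ((y : ℂ) + I * ((x - t : ℝ) : ℂ)) / (((x - t) ^ 2 + y ^ 2 : ℝ) : ℂ) := by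
    rw [div_eq_div_iff h1 h2]
    push_cast
    linear_combination (-((x : ℂ) - t) * y) * Complex.I_sq
  have : I * (f t / ((x : ℂ) + y * I - t)) = (I / ((x : ℂ) + y * I - t)) * f t := by ring
  rw [this, key]
  ring

lemma FF_diff {f : ℝ → ℂ} (hf : Integrable f) : DifferentiableOn ℂ (FF f) {z | 0 < z.im} := by
  intro z hz
  simp only [mem_ofPred_eq] at hz
  apply DifferentiableAt.differentiableWithinAt
  apply DifferentiableAt.const_mul
  have hball : ∀ w ∈ Metric.ball z (z.im / 2), z.im / 2 < w.im := by
    intro w hw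
    have h1 := Complex.abs_im_le_norm (w - z)
    rw [Metric.mem_ball, dist_eq_norm] at hw
    have := (abs_le.1 (h1.trans hw.le)).1
    have h3 := (abs_lt.1 (h1.trans_lt hw)).1
    simp at h3
    linarith
  have := hasDerivAt_integral_of_dominated_loc_of_deriv_le (μ := (volume : Measure ℝ))
    (F := fun w (t : ℝ) => f t / (w - t)) (F' := fun w (t : ℝ) => - f t / (w - t) ^ 2) (x₀ := z)
    (s := Metric.ball z (z.im / 2))
    (bound := fun t => ‖f t‖ * ((z.im / 2) ^ 2)⁻¹) (Metric.ball_mem_nhds z (by positivity)) ?_ (FF_integrable hf hz) ?_ ?_ ?_ ?_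
  · exact this.2.differentiableAt
  · filter_upwards [Metric.ball_mem_nhds z (show 0 < z.im / 2 by positivity)] with w hw
    exact (FF_integrable hf (by have := hball w hw; linarith)).aestronglyMeasurable
  · simp_rw [div_eq_mul_inv]
    exact hf.aestronglyMeasurable.neg.mul (by fun_prop : Measurable fun t : ℝ => ((z - t) ^ 2)⁻¹).aestronglyMeasurable
  · refine Eventually.of_forall fun t w hw => ?_
    have h1 := hball w hw
    rw [norm_div, norm_neg, norm_pow, div_eq_mul_inv]
    have h2 := im_le_sub (z := w) (by linarith) t
    gcongr
    linarith
  · exact hf.norm.mul_const _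
  · refine Eventually.of_forall fun t w hw => ?_
    have h1 := hball w hw
    have hne := sub_ne (z := w) (by linarith) t
    have := ((hasDerivAt_id w).sub_const (t : ℂ)).fun_inv hne
    have h2 := this.const_mul (f t)
    simp only [id] at h2
    simp_rw [div_eq_mul_inv] at h2 ⊢
    have e : -f t * ((w - (t : ℂ)) ^ 2)⁻¹ = f t * (-1 * ((w - (t : ℂ)) ^ 2)⁻¹) := by ring
    rw [e]
    exact h2

lemma FF_add {f g : ℝ → ℂ} (hf : Integrable f) (hg : Integrable g) {z : ℂ} (hz : 0 < z.im) :
    FF (fun t => f t + g t) z = FF f z + FF g z := by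
  unfold FF
  rw [← mul_add, ← integral_add (FF_integrable hf hz) (FF_integrable hg hz)]
  simp_rw [add_div]

lemma FF_smul (f : ℝ → ℂ) (c : ℂ) (z : ℂ) : FF (fun t => c * f t) z = c * FF f z := by
  unfold FF
  simp_rw [mul_div_assoc]
  rw [integral_const_mul]; ring

lemma FF_re_nonneg {r : ℝ → ℝ} (hr : Integrable r) (h0 : ∀ t, 0 ≤ r t) {z : ℂ} (hz : 0 < z.im) :
    0 ≤ (FF (fun t => (r t : ℂ)) z).re ∧ (FF (fun t => (r t : ℂ)) z).re = (PI (fun t => (r t : ℂ)) z.re z.im).re := by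
  have e : z = (z.re : ℂ) + z.im * I := (Complex.re_add_im z).symm
  have e1 : PI (fun t => (r t : ℂ)) z.re z.im = ((∫ t, pk z.im (z.re - t) * r t : ℝ) : ℂ) := by
    rw [PI, ← integral_complex_ofReal]; push_cast; rfl
  have e2 : QI (fun t => (r t : ℂ)) z.re z.im = ((∫ t, qk z.im (z.re - t) * r t : ℝ) : ℂ) := by
    rw [QI, ← integral_complex_ofReal]; push_cast; rfl
  have e3 := FF_eq (integrable_toC hr) z.re hz
  rw [← e] at e3
  have e4 : (FF (fun t => (r t : ℂ)) z).re = (PI (fun t => (r t : ℂ)) z.re z.im).re := by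
    rw [e3, e2]; simp
  refine ⟨?_, e4⟩
  rw [e4, e1, ofReal_re]
  exact integral_nonneg fun t => mul_nonneg (pk_nonneg hz _) (h0 t)

lemma vert_cont {F : ℂ → ℂ} (hF : DifferentiableOn ℂ F {z | 0 < z.im}) (x : ℝ) :
    ContinuousOn (fun ε : ℝ => F (x + ε * I)) (Ioi 0) :=
  hF.continuousOn.comp (by fun_prop) (fun ε hε => by simpa using hε)

lemma vert_tendsto (x : ℝ) : Tendsto (fun ε : ℝ => (x : ℂ) + ε * I) (𝓝[>] 0) (𝓝 x) := by
  have : Continuous (fun ε : ℝ => (x : ℂ) + ε * I) := by fun_prop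
  have h := this.tendsto 0
  simp only [Complex.ofReal_zero, zero_mul, add_zero] at h
  exact h.mono_left nhdsWithin_le_nhds

lemma FF_pos_limit {r : ℝ → ℝ} (hr : Integrable r) (h0 : ∀ t, 0 ≤ r t) :
    ∀ᵐ x : ℝ, ∃ L, Tendsto (fun ε : ℝ => FF (fun t => (r t : ℂ)) (x + ε * I)) (𝓝[>] 0) (𝓝 L) := by
  set F := FF (fun t => (r t : ℂ)) with hF
  have hFd : DifferentiableOn ℂ F {z | 0 < z.im} := FF_diff (integrable_toC hr)
  have hI : ∀ z : ℂ, 0 < z.im → z + I ≠ 0 := by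
    intro z hz h
    have := congrArg Complex.im h
    simp at this; linarith
  have hVd : DifferentiableOn ℂ (fun z => Complex.exp (- F z) / (z + I) ^ 2) {z | 0 < z.im} := by
    apply DifferentiableOn.div hFd.neg.cexp (by fun_prop)
    intro z hz
    exact pow_ne_zero _ (hI z hz)
  have hfat := fatou _ hVd (by
    intro z hz
    rw [norm_div, Complex.norm_exp, norm_pow, div_eq_mul_inv]
    have h1 : Real.exp ((-F z).re) ≤ 1 := by
      rw [Real.exp_le_one_iff, neg_re]
      linarith [(FF_re_nonneg hr h0 hz).1]
    have h2 : 1 + z.re ^ 2 ≤ ‖z + I‖ ^ 2 := by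
      rw [← Complex.normSq_eq_norm_sq, Complex.normSq_apply]
      simp
      nlinarith
    calc _ ≤ 1 * (‖z + I‖ ^ 2)⁻¹ := by gcongr
      _ ≤ _ := by rw [one_mul]; gcongr)
  filter_upwards [hfat, PI_tendsto _ (integrable_toC hr)] with x hx hP
  obtain ⟨L, hL⟩ := hx
  have hm := hL.mul (((vert_tendsto x).add_const I).pow 2)
  have hm2 : Tendsto (fun ε : ℝ => Complex.exp (- F (x + ε * I))) (𝓝[>] 0) (𝓝 (L * (x + I) ^ 2)) := by
    refine hm.congr' ?_
    filter_upwards [self_mem_nhdsWithin] with ε hε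
    exact div_mul_cancel₀ _ (pow_ne_zero _ (hI _ (by simpa using hε)))
  have hne : L * (x + I) ^ 2 ≠ 0 := by
    have t1 := hm2.norm
    have t2 : Tendsto (fun ε : ℝ => ‖Complex.exp (- F (x + ε * I))‖) (𝓝[>] 0) (𝓝 (Real.exp (-((Real.pi : ℂ) * r x).re))) := by
      have t3 := (Real.continuous_exp.tendsto _).comp ((Complex.continuous_re.tendsto _).comp hP).neg
      refine t3.congr' ?_
      filter_upwards [self_mem_nhdsWithin] with ε hε
      simp only [Function.comp]
      rw [Complex.norm_exp, neg_re, (FF_re_nonneg hr h0 (z := x + ε * I) (by simpa using hε)).2]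
      simp
    have := tendsto_nhds_unique t1 t2
    rw [← norm_ne_zero_iff, this]
    exact (Real.exp_pos _).ne'
  obtain ⟨l, hl⟩ := exp_lift (fun ε : ℝ => - F (x + ε * I)) (vert_cont hFd x).neg _ hne hm2
  exact ⟨-l, by simpa using hl.neg⟩


def Good (F : ℂ → ℂ) : Prop := ∃ G : ℕ → ℂ → ℂ,
  (∀ n, DifferentiableOn ℂ (G n) {z | 0 < z.im}) ∧
  (∀ n z, 0 < z.im → ‖G n z‖ ≤ 1) ∧
  (∀ z, 0 < z.im → Tendsto (fun n => G n z) atTop (𝓝 1)) ∧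
  (∀ n, ∃ C, ∀ z, 0 < z.im → ‖G n z * F z‖ ≤ C) ∧
  (∀ᵐ x : ℝ, ∃ g : ℕ → ℂ, (∀ n, Tendsto (fun ε : ℝ => G n (x + ε * I)) (𝓝[>] 0) (𝓝 (g n))) ∧
    Tendsto g atTop (𝓝 1))

def HasLim (F : ℂ → ℂ) : Prop :=
  ∀ᵐ x : ℝ, ∃ L, Tendsto (fun ε : ℝ => F (x + ε * I)) (𝓝[>] 0) (𝓝 L)

lemma Good.add {F₁ F₂ F : ℂ → ℂ} (h₁ : Good F₁) (h₂ : Good F₂)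
    (h : ∀ z, 0 < z.im → F z = F₁ z + F₂ z) : Good F := by
  obtain ⟨G, a, b, c, d, e⟩ := h₁
  obtain ⟨G', a', b', c', d', e'⟩ := h₂
  refine ⟨fun n z => G n z * G' n z, fun n => (a n).mul (a' n), ?_, ?_, ?_, ?_⟩
  · intro n z hz
    rw [norm_mul]
    exact mul_le_one₀ (b n z hz) (norm_nonneg _) (b' n z hz)
  · intro z hz
    simpa using (c z hz).mul (c' z hz)
  · intro n
    obtain ⟨C, hC⟩ := d n
    obtain ⟨C', hC'⟩ := d' n
    refine ⟨C + C', fun z hz => ?_⟩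
    have e1 : G n z * G' n z * F z = G' n z * (G n z * F₁ z) + G n z * (G' n z * F₂ z) := by
      rw [h z hz]; ring
    rw [e1]
    refine (norm_add_le _ _).trans (add_le_add ?_ ?_)
    · rw [norm_mul]
      exact (mul_le_of_le_one_left (norm_nonneg _) (b' n z hz)).trans (hC z hz)
    · rw [norm_mul]
      exact (mul_le_of_le_one_left (norm_nonneg _) (b n z hz)).trans (hC' z hz)
  · filter_upwards [e, e'] with x hx hx'
    obtain ⟨g, h1, h2⟩ := hx
    obtain ⟨g', h1', h2'⟩ := hx'
    exact ⟨fun n => g n * g' n, fun n => (h1 n).mul (h1' n), by simpa using h2.mul h2'⟩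

lemma Good.smul {F F' : ℂ → ℂ} (h : Good F) (k : ℂ)
    (hh : ∀ z, 0 < z.im → F' z = k * F z) : Good F' := by
  obtain ⟨G, a, b, c, d, e⟩ := h
  refine ⟨G, a, b, c, fun n => ?_, e⟩
  obtain ⟨C, hC⟩ := d n
  refine ⟨‖k‖ * C, fun z hz => ?_⟩
  have : G n z * F' z = k * (G n z * F z) := by rw [hh z hz]; ring
  rw [this, norm_mul]
  gcongr
  exact hC z hz

lemma HasLim.add {F₁ F₂ F : ℂ → ℂ} (h₁ : HasLim F₁) (h₂ : HasLim F₂)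
    (h : ∀ z, 0 < z.im → F z = F₁ z + F₂ z) : HasLim F := by
  filter_upwards [h₁, h₂] with x hx hx'
  obtain ⟨L, hL⟩ := hx
  obtain ⟨L', hL'⟩ := hx'
  refine ⟨L + L', (hL.add hL').congr' ?_⟩
  filter_upwards [self_mem_nhdsWithin] with ε hε
  exact (h _ (by simpa using hε)).symm

lemma HasLim.smul {F F' : ℂ → ℂ} (h : HasLim F) (k : ℂ)
    (hh : ∀ z, 0 < z.im → F' z = k * F z) : HasLim F' := by
  filter_upwards [h] with x hx
  obtain ⟨L, hL⟩ := hx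
  refine ⟨k * L, (hL.const_mul k).congr' ?_⟩
  filter_upwards [self_mem_nhdsWithin] with ε hε
  exact (hh _ (by simpa using hε)).symm

lemma norm_add_ge {L : ℂ} (hL : 0 ≤ L.re) (n : ℕ) :
    (n + 1 : ℝ) ≤ ‖((n : ℂ) + 1) + L‖ := by
  have := Complex.re_le_norm (((n : ℂ) + 1) + L)
  simp at this
  linarith

lemma norm_add_ge' {L : ℂ} (hL : 0 ≤ L.re) (n : ℕ) :
    ‖L‖ ≤ ‖((n : ℂ) + 1) + L‖ := by
  rw [← sq_le_sq₀ (norm_nonneg _) (norm_nonneg _), ← Complex.normSq_eq_norm_sq, ← Complex.normSq_eq_norm_sq,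
    Complex.normSq_apply, Complex.normSq_apply]
  simp
  have : (0 : ℝ) ≤ n := n.cast_nonneg
  nlinarith

lemma norm_add_ne {L : ℂ} (hL : 0 ≤ L.re) (n : ℕ) : ((n : ℂ) + 1) + L ≠ 0 := by
  rw [← norm_pos_iff]
  exact lt_of_lt_of_le (by positivity) (norm_add_ge hL n)

lemma norm_nat_add_one (n : ℕ) : ‖((n : ℂ) + 1)‖ = n + 1 := by
  have : ((n : ℂ) + 1) = ((n + 1 : ℕ) : ℂ) := by push_cast; rfl
  rw [this, Complex.norm_natCast]; push_cast; rfl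

lemma lim_one {L : ℂ} (hL : 0 ≤ L.re) :
    Tendsto (fun n : ℕ => ((n : ℂ) + 1) / (((n : ℂ) + 1) + L)) atTop (𝓝 1) := by
  have h : Tendsto (fun n : ℕ => L / (((n : ℂ) + 1) + L)) atTop (𝓝 0) := by
    apply squeeze_zero_norm (a := fun n : ℕ => ‖L‖ * (1 / ((n : ℝ) + 1)))
    · intro n
      rw [norm_div, div_eq_mul_inv, one_div]
      gcongr
      exact norm_add_ge hL n
    · simpa using (tendsto_one_div_add_atTop_nhds_zero_nat (𝕜 := ℝ)).const_mul ‖L‖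
  have h2 := (tendsto_const_nhds (x := (1 : ℂ))).sub h
  rw [sub_zero] at h2
  refine h2.congr fun n => ?_
  have := norm_add_ne hL n
  field_simp
  ring

lemma good_pos {r : ℝ → ℝ} (hr : Integrable r) (h0 : ∀ t, 0 ≤ r t) :
    Good (FF (fun t => (r t : ℂ))) := by
  set F := FF (fun t => (r t : ℂ)) with hF
  have hFd : DifferentiableOn ℂ F {z | 0 < z.im} := FF_diff (integrable_toC hr)
  have hre : ∀ z : ℂ, 0 < z.im → 0 ≤ (F z).re := fun z hz => (FF_re_nonneg hr h0 hz).1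
  refine ⟨fun n z => ((n : ℂ) + 1) / (((n : ℂ) + 1) + F z), ?_, ?_, ?_, ?_, ?_⟩
  · intro n
    apply DifferentiableOn.div (by fun_prop) (hFd.const_add _)
    intro z hz
    exact norm_add_ne (hre z hz) n
  · intro n z hz
    rw [norm_div, norm_nat_add_one]
    exact div_le_one_of_le₀ (norm_add_ge (hre z hz) n) (norm_nonneg _)
  · intro z hz
    exact lim_one (hre z hz)
  · intro n
    refine ⟨n + 1, fun z hz => ?_⟩
    rw [div_mul_eq_mul_div, mul_div_assoc, norm_mul, norm_nat_add_one, norm_div]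
    apply mul_le_of_le_one_right (by positivity)
    exact div_le_one_of_le₀ (norm_add_ge' (hre z hz) n) (norm_nonneg _)
  · filter_upwards [FF_pos_limit hr h0] with x hx
    obtain ⟨L, hL⟩ := hx
    have hLre : 0 ≤ L.re := by
      refine ge_of_tendsto ((Complex.continuous_re.tendsto _).comp hL) ?_
      filter_upwards [self_mem_nhdsWithin] with ε hε
      exact hre _ (by simpa using hε)
    refine ⟨fun n => ((n : ℂ) + 1) / (((n : ℂ) + 1) + L), fun n => ?_, lim_one hLre⟩
    exact tendsto_const_nhds.div (tendsto_const_nhds.add hL) (norm_add_ne hLre n)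

def NiceF (f : ℝ → ℂ) : Prop := Integrable f ∧ Good (FF f) ∧ HasLim (FF f)

lemma NiceF.add {f g : ℝ → ℂ} (hf : NiceF f) (hg : NiceF g) : NiceF (fun t => f t + g t) :=
  ⟨hf.1.add hg.1, hf.2.1.add hg.2.1 fun _ hz => FF_add hf.1 hg.1 hz,
    hf.2.2.add hg.2.2 fun _ hz => FF_add hf.1 hg.1 hz⟩

lemma NiceF.smul {f : ℝ → ℂ} (hf : NiceF f) (k : ℂ) : NiceF (fun t => k * f t) :=
  ⟨hf.1.const_mul k, hf.2.1.smul k fun _ _ => FF_smul f k _,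
    hf.2.2.smul k fun _ _ => FF_smul f k _⟩

lemma NiceF_pos {r : ℝ → ℝ} (hr : Integrable r) (h0 : ∀ t, 0 ≤ r t) : NiceF (fun t => (r t : ℂ)) :=
  ⟨integrable_toC hr, good_pos hr h0, FF_pos_limit hr h0⟩

lemma NiceF_real {r : ℝ → ℝ} (hr : Integrable r) : NiceF (fun t => (r t : ℂ)) := by
  have h := (NiceF_pos hr.pos_part (fun t => le_max_right _ _)).add
    ((NiceF_pos hr.neg_part (fun t => le_max_right _ _)).smul (-1))
  convert h using 2 with t
  rcases le_total 0 (r t) with h | h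
  · simp [h]
  · simp [h]

lemma NiceF_all {f : ℝ → ℂ} (hf : Integrable f) : NiceF f := by
  have h := (NiceF_real hf.re).add ((NiceF_real hf.im).smul I)
  convert h using 2 with t
  simp [mul_comm I]

lemma poisson_good {F : ℂ → ℂ} (hG : Good F) (hF : DifferentiableOn ℂ F {z | 0 < z.im})
    {b : ℝ → ℂ} (hb : Integrable b)
    (hlim : ∀ᵐ x : ℝ, Tendsto (fun ε : ℝ => F (x + ε * I)) (𝓝[>] 0) (𝓝 (b x)))
    (x : ℝ) {y : ℝ} (hy : 0 < y) : PI b x y = Real.pi * F (x + y * I) := by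
  obtain ⟨G, hGd, hG1, hGlim, hGC, hGv⟩ := hG
  have hex : ∀ t : ℝ, ∃ g : ℕ → ℂ, (∃ g : ℕ → ℂ, (∀ n, Tendsto (fun ε : ℝ => G n (t + ε * I)) (𝓝[>] 0) (𝓝 (g n))) ∧
    Tendsto g atTop (𝓝 1)) → (∀ n, Tendsto (fun ε : ℝ => G n (t + ε * I)) (𝓝[>] 0) (𝓝 (g n))) ∧
    Tendsto g atTop (𝓝 1) := by
    intro t
    by_cases h : ∃ g : ℕ → ℂ, (∀ n, Tendsto (fun ε : ℝ => G n (t + ε * I)) (𝓝[>] 0) (𝓝 (g n))) ∧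
      Tendsto g atTop (𝓝 1)
    · obtain ⟨g, hg⟩ := h
      exact ⟨g, fun _ => hg⟩
    · exact ⟨fun _ => 0, fun h' => absurd h' h⟩
  choose g hg using hex
  have hg' : ∀ᵐ t : ℝ, (∀ n, Tendsto (fun ε : ℝ => G n (t + ε * I)) (𝓝[>] 0) (𝓝 (g t n))) ∧
    Tendsto (g t) atTop (𝓝 1) := by
    filter_upwards [hGv] with t ht using hg t ht
  have hbd : ∀ᵐ t : ℝ, ∀ n, ‖g t n‖ ≤ 1 := by
    filter_upwards [hg'] with t ht n
    refine le_of_tendsto (ht.1 n).norm ?_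
    filter_upwards [self_mem_nhdsWithin] with ε hε
    exact hG1 n _ (by simpa using hε)
  have hUd : ∀ n, DifferentiableOn ℂ (fun z => G n z * F z) {z | 0 < z.im} := fun n => (hGd n).mul hF
  have hUc : ∀ n (a : ℝ), 0 < a → Continuous (fun t : ℝ => G n (t + a * I) * F (t + a * I)) :=
    fun n a ha => slice_cont _ (hUd n) ha
  have hUl : ∀ n, ∀ᵐ t : ℝ, Tendsto (fun ε : ℝ => G n (t + ε * I) * F (t + ε * I)) (𝓝[>] 0) (𝓝 (g t n * b t)) := by
    intro n
    filter_upwards [hg', hlim] with t h1 h2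
    exact (h1.1 n).mul h2
  have hpkm : AEStronglyMeasurable (fun t : ℝ => (pk y (x - t) : ℂ)) volume :=
    (integrable_toC (pk_integrable hy x)).aestronglyMeasurable
  have hgm : ∀ n, AEStronglyMeasurable (fun t => g t n * b t) volume := by
    intro n
    have hseq : Tendsto (fun k : ℕ => 1 / ((k : ℝ) + 1)) atTop (𝓝[>] 0) :=
      tendsto_nhdsWithin_iff.2 ⟨tendsto_one_div_add_atTop_nhds_zero_nat,
        Eventually.of_forall fun k => by simp only [mem_Ioi]; positivity⟩
    refine aestronglyMeasurable_of_tendsto_ae atTop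
      (f := fun (k : ℕ) (t : ℝ) => G n (t + (1 / ((k : ℝ) + 1) : ℝ) * I) * F (t + (1 / ((k : ℝ) + 1) : ℝ) * I)) ?_ ?_
    · intro k
      exact (hUc n _ (by positivity)).aestronglyMeasurable
    · filter_upwards [hUl n] with t ht
      exact ht.comp hseq
  have step1 : ∀ n, PI (fun t => g t n * b t) x y = Real.pi * (G n (x + y * I) * F (x + y * I)) := by
    intro n
    obtain ⟨C, hC⟩ := hGC n
    have h1 : Tendsto (fun a : ℝ => PI (fun t => G n (t + a * I) * F (t + a * I)) x y) (𝓝[>] 0)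
        (𝓝 (PI (fun t => g t n * b t) x y)) := by
      apply tendsto_integral_filter_of_dominated_convergence (fun t => pk y (x - t) * C)
      · filter_upwards [self_mem_nhdsWithin] with a ha
        exact hpkm.mul (hUc n a ha).aestronglyMeasurable
      · filter_upwards [self_mem_nhdsWithin] with a ha
        refine Eventually.of_forall fun t => ?_
        rw [norm_mul, Complex.norm_real, Real.norm_of_nonneg (pk_nonneg hy _)]
        exact mul_le_mul_of_nonneg_left (hC _ (by simpa using ha)) (pk_nonneg hy _)
      · exact (pk_integrable hy x).mul_const C
      · filter_upwards [hUl n] with t ht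
        exact Filter.Tendsto.const_mul _ ht
    have h2 : Tendsto (fun a : ℝ => (Real.pi : ℂ) * (G n (x + (y + a) * I) * F (x + (y + a) * I))) (𝓝[>] 0)
        (𝓝 (Real.pi * (G n (x + y * I) * F (x + y * I)))) := by
      apply Filter.Tendsto.const_mul
      have hz : (0 : ℝ) < ((x : ℂ) + y * I).im := by simpa using hy
      have c1 : ContinuousAt (fun z => G n z * F z) (x + y * I) :=
        ((hUd n).continuousOn).continuousAt ((isOpen_lt continuous_const Complex.continuous_im).mem_nhds hz)
      have c2 : Tendsto (fun a : ℝ => (x : ℂ) + (y + a) * I) (𝓝[>] 0) (𝓝 (x + y * I)) := by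
        have : Continuous (fun a : ℝ => (x : ℂ) + (y + a) * I) := by fun_prop
        have h := this.tendsto 0
        simp only [Complex.ofReal_zero, add_zero] at h
        exact h.mono_left nhdsWithin_le_nhds
      exact c1.tendsto.comp c2
    refine tendsto_nhds_unique (h1.congr' ?_) h2
    filter_upwards [self_mem_nhdsWithin] with a ha
    exact poisson_rep _ (hUd n) C hC ha hy x
  have h3 : Tendsto (fun n => PI (fun t => g t n * b t) x y) atTop (𝓝 (PI b x y)) := by
    apply tendsto_integral_of_dominated_convergence (fun t => ‖(pk y (x - t) : ℂ) * b t‖)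
    · intro n
      exact hpkm.mul (hgm n)
    · exact (PI_integrable hb hy x).norm
    · intro n
      filter_upwards [hbd] with t ht
      rw [norm_mul, norm_mul, norm_mul]
      gcongr
      exact mul_le_of_le_one_left (norm_nonneg _) (ht n)
    · filter_upwards [hg'] with t ht
      apply Filter.Tendsto.const_mul
      simpa using ht.2.mul_const (b t)
  have h4 : Tendsto (fun n => (Real.pi : ℂ) * (G n (x + y * I) * F (x + y * I))) atTop
      (𝓝 (Real.pi * F (x + y * I))) := by
    apply Filter.Tendsto.const_mul
    simpa using (hGlim (x + y * I) (by simpa using hy)).mul_const (F (x + y * I))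
  simp_rw [step1] at h3
  exact tendsto_nhds_unique h3 h4

lemma hilbert_lim {g : ℝ → ℂ} {x : ℝ} {L : ℂ}
    (h1 : Tendsto (fun ε => QI g x ε) (𝓝[>] 0) (𝓝 L))
    (h2 : Tendsto (fun ε => QI g x ε - trunc g x ε) (𝓝[>] 0) (𝓝 0)) :
    (Real.pi : ℂ) * hilbertT g x = L := by
  have h3 : Tendsto (fun ε => trunc g x ε) (𝓝[>] 0) (𝓝 L) := by
    simpa using h1.sub h2
  have h4 : limUnder (𝓝[>] (0 : ℝ)) (fun ε => trunc g x ε) = L := h3.limUnder_eq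
  have hpi : (Real.pi : ℂ) ≠ 0 := by exact_mod_cast Real.pi_ne_zero
  have h5 : hilbertT g x = (Real.pi)⁻¹ • L := by
    rw [← h4]; rfl
  rw [h5, Complex.real_smul, Complex.ofReal_inv, ← mul_assoc, mul_inv_cancel₀ hpi, one_mul]

lemma QI_eq_PI {f : ℝ → ℂ} (hf : Integrable f) (hh : Integrable (hilbertT f)) (x : ℝ) {y : ℝ} (hy : 0 < y) :
    QI f x y = PI (hilbertT f) x y := by
  obtain ⟨-, hG, hL⟩ := NiceF_all hf
  have hI : I ≠ 0 := Complex.I_ne_zero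
  have hpi : (Real.pi : ℂ) ≠ 0 := by exact_mod_cast Real.pi_ne_zero
  have hlim : ∀ᵐ x : ℝ, Tendsto (fun ε : ℝ => FF f (x + ε * I)) (𝓝[>] 0)
      (𝓝 (Real.pi * f x + (I * Real.pi) * hilbertT f x)) := by
    filter_upwards [hL, PI_tendsto f hf, QI_trunc f hf] with x h1 h2 h3
    obtain ⟨L, h1⟩ := h1
    have h4 : Tendsto (fun ε => QI f x ε) (𝓝[>] 0) (𝓝 (-I * (L - Real.pi * f x))) := by
      refine ((h1.sub h2).const_mul (-I)).congr' ?_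
      filter_upwards [self_mem_nhdsWithin] with ε hε
      rw [FF_eq hf x hε]
      linear_combination (-QI f x ε) * Complex.I_sq
    have h5 := hilbert_lim h4 h3
    have h6 : (Real.pi * f x + (I * Real.pi) * hilbertT f x) = L := by
      rw [mul_assoc, h5]
      linear_combination (-(L - Real.pi * f x)) * Complex.I_sq
    rw [h6]
    exact h1
  have key := poisson_good hG (FF_diff hf) ((hf.const_mul (Real.pi : ℂ)).add (hh.const_mul (I * Real.pi))) hlim x hy
  rw [FF_eq hf x hy] at key
  have e : PI ((fun x => (Real.pi : ℂ) * f x) + fun x => (I * Real.pi) * hilbertT f x) x y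
      = Real.pi * PI f x y + (I * Real.pi) * PI (hilbertT f) x y := by
    unfold PI
    rw [← integral_const_mul, ← integral_const_mul, ← integral_add
      ((PI_integrable hf hy x).const_mul _) ((PI_integrable hh hy x).const_mul _)]
    congr 1; ext t
    simp only [Pi.add_apply]
    ring
  rw [e] at key
  have : (I * Real.pi) * QI f x y = (I * Real.pi) * PI (hilbertT f) x y := by
    linear_combination -key
  exact mul_left_cancel₀ (mul_ne_zero hI hpi) this

lemma div_qmp {t : ℝ} (ht : 0 < t) : Measure.QuasiMeasurePreserving (fun x : ℝ => x / t) volume volume := by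
  refine ⟨by fun_prop, ?_⟩
  have e : (fun x : ℝ => x / t) = fun x => x * t⁻¹ := by ext x; rw [div_eq_mul_inv]
  rw [e, Real.map_volume_mul_right (inv_ne_zero ht.ne')]
  exact Measure.smul_absolutelyContinuous

lemma hausd_int {φ : ℝ → ℝ} (hint : IntegrableOn φ (Set.Ioi 0)) {f : ℝ → ℂ} (hf : Integrable f) :
    Integrable (fun p : ℝ × ℝ => (φ p.1 / p.1) • f (p.2 / p.1))
      ((volume.restrict (Ioi 0)).prod volume) := by
  have hqmp : Measure.QuasiMeasurePreserving (fun p : ℝ × ℝ => p.2 / p.1)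
      ((volume.restrict (Ioi 0)).prod volume) volume := by
    apply QuasiMeasurePreserving.prod_of_right (by fun_prop)
    filter_upwards [ae_restrict_mem measurableSet_Ioi] with t ht using div_qmp ht
  have hm : AEStronglyMeasurable (fun p : ℝ × ℝ => (φ p.1 / p.1) • f (p.2 / p.1))
      ((volume.restrict (Ioi 0)).prod volume) := by
    refine AEStronglyMeasurable.smul (f := fun p : ℝ × ℝ => φ p.1 / p.1) (g := fun p : ℝ × ℝ => f (p.2 / p.1)) ?_ ?_
    · have : AEStronglyMeasurable (fun t => φ t / t) (volume.restrict (Ioi 0)) := by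
        simp_rw [div_eq_mul_inv]
        exact hint.aestronglyMeasurable.mul (by fun_prop : Measurable fun t : ℝ => t⁻¹).aestronglyMeasurable
      exact this.comp_fst
    · exact hf.aestronglyMeasurable.comp_quasiMeasurePreserving hqmp
  rw [integrable_prod_iff hm]
  constructor
  · filter_upwards [ae_restrict_mem measurableSet_Ioi] with t ht
    exact (hf.comp_div (ne_of_gt ht)).smul (φ t / t)
  · have h : Integrable (fun t => ‖φ t‖ * ∫ x, ‖f x‖) (volume.restrict (Ioi 0)) := hint.norm.mul_const _
    refine h.congr ?_
    filter_upwards [ae_restrict_mem measurableSet_Ioi] with t ht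
    have ht' : (0 : ℝ) < t := ht
    simp_rw [norm_smul]
    rw [integral_const_mul, Measure.integral_comp_div (fun x => ‖f x‖), abs_of_pos ht', smul_eq_mul,
      norm_div, Real.norm_of_nonneg ht'.le]
    field_simp

lemma hausd_integrable {φ : ℝ → ℝ} (hint : IntegrableOn φ (Set.Ioi 0)) {f : ℝ → ℂ} (hf : Integrable f) :
    Integrable (hausdorffR φ f) := (hausd_int hint hf).integral_prod_right

lemma hausd_fubini {φ : ℝ → ℝ} (hint : IntegrableOn φ (Set.Ioi 0)) {f : ℝ → ℂ} (hf : Integrable f)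
    {k : ℝ → ℝ} (hk : Measurable k) {C : ℝ} (hC : ∀ u, |k u| ≤ C) (x : ℝ) :
    ∫ y, (k (x - y) : ℂ) * hausdorffR φ f y =
      ∫ t in Ioi 0, (φ t / t) • ∫ y, (k (x - y) : ℂ) * f (y / t) := by
  have h1 : Integrable (fun p : ℝ × ℝ => (k (x - p.2) : ℂ) * ((φ p.1 / p.1) • f (p.2 / p.1)))
      ((volume.restrict (Ioi 0)).prod volume) := by
    apply (hausd_int hint hf).bdd_mul (c := C)
    · exact (by fun_prop : Measurable fun p : ℝ × ℝ => (k (x - p.2) : ℂ)).aestronglyMeasurable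
    · exact Eventually.of_forall fun p => by simpa using hC (x - p.2)
  have h2 := integral_integral_swap (f := fun t y => (k (x - y) : ℂ) * ((φ t / t) • f (y / t))) h1
  unfold hausdorffR
  simp_rw [← integral_const_mul]
  rw [← h2]
  congr 1; ext t
  rw [← integral_smul]
  congr 1; ext y
  rw [mul_smul_comm]

lemma scale_int {k : ℝ → ℝ} (f : ℝ → ℂ) (x : ℝ) {t : ℝ} (ht : 0 < t) :
    ∫ y, (k (x - y) : ℂ) * f (y / t) = ∫ s, ((t * k (t * (x / t - s)) : ℝ) : ℂ) * f s := by
  have h := Measure.integral_comp_div (fun s => (k (t * (x / t - s)) : ℂ) * f s) t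
  have e : ∀ y, t * (x / t - y / t) = x - y := by intro y; field_simp
  simp_rw [e] at h
  rw [h, abs_of_pos ht, ← integral_smul]
  congr 1; ext s
  rw [Complex.real_smul]; push_cast; ring

lemma PI_hausd {φ : ℝ → ℝ} (hint : IntegrableOn φ (Set.Ioi 0)) {f : ℝ → ℂ} (hf : Integrable f)
    (x : ℝ) {ε : ℝ} (hε : 0 < ε) :
    PI (hausdorffR φ f) x ε = ∫ t in Ioi 0, (φ t / t) • PI f (x / t) (ε / t) := by
  rw [PI, hausd_fubini hint hf (pk_cont hε).measurable (pk_bound hε) x]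
  refine setIntegral_congr_fun measurableSet_Ioi fun t ht => ?_
  have ht' : (0 : ℝ) < t := ht
  simp only [PI]
  rw [scale_int f x ht']
  congr 2; ext s
  congr 2
  unfold pk
  field_simp

lemma QI_hausd {φ : ℝ → ℝ} (hint : IntegrableOn φ (Set.Ioi 0)) {f : ℝ → ℂ} (hf : Integrable f)
    (x : ℝ) {ε : ℝ} (hε : 0 < ε) :
    QI (hausdorffR φ f) x ε = ∫ t in Ioi 0, (φ t / t) • QI f (x / t) (ε / t) := by
  rw [QI, hausd_fubini hint hf (qk_cont hε).measurable (qk_bound hε) x]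
  refine setIntegral_congr_fun measurableSet_Ioi fun t ht => ?_
  have ht' : (0 : ℝ) < t := ht
  simp only [QI]
  rw [scale_int f x ht']
  congr 2; ext s
  congr 2
  unfold qk
  field_simp

/-- Theorem 3.4 (commuting): if `∫₀^∞ φ(t) dt < ∞`, then `H_φ` commutes with the
Hilbert transform on the real Hardy space `H¹(ℝ)`. -/
theorem hausdorff_commutes_hilbert_H1 (φ : ℝ → ℝ) (hφ : ∀ t, 0 ≤ φ t)
    (hloc : LocallyIntegrableOn φ (Set.Ioi 0))
    (hint : IntegrableOn φ (Set.Ioi 0))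
    (f : ℝ → ℂ) (hf : MemH1 f) :
    hausdorffR φ (hilbertT f) =ᵐ[volume] hilbertT (hausdorffR φ f) := by
  obtain ⟨h1, h2⟩ := hf
  filter_upwards [PI_tendsto _ (hausd_integrable hint h2), QI_trunc _ (hausd_integrable hint h1)] with x hP hQ
  have h3 : Tendsto (fun ε => QI (hausdorffR φ f) x ε) (𝓝[>] 0)
      (𝓝 (Real.pi * hausdorffR φ (hilbertT f) x)) := by
    refine hP.congr' ?_
    filter_upwards [self_mem_nhdsWithin] with ε hε
    have hε' : (0 : ℝ) < ε := hε
    rw [PI_hausd hint h2 x hε', QI_hausd hint h1 x hε']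
    refine setIntegral_congr_fun measurableSet_Ioi fun t ht => ?_
    have ht' : (0 : ℝ) < t := ht
    rw [QI_eq_PI h1 h2 _ (div_pos hε' ht')]
  have hpi : (Real.pi : ℂ) ≠ 0 := by exact_mod_cast Real.pi_ne_zero
  exact (mul_left_cancel₀ hpi (hilbert_lim h3 hQ)).symm
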